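/- arXiv:math/0504195 — 4 statements merged into one kernel-verified Lean document; each statement's English description precedes it below -/
import Mathlib

section
/- For n ≥ 2 and k ≥ 0, the numbers J_{2n,k} satisfy the recurrence 2n·J_{2n,k} = [k(k+1) + 2n - 2] J_{2n-2,k} + 2[(k-1)(2n-k-1) + 1] J_{2n-2,k-1} + [(2n-k)(2n-k+1) + 2n - 2] J_{2n-2,k-2}, with the convention J_{2n,k} = 0 for k < 0. -/
open Finset Polynomial

/-- Number of descents of a permutation of `Fin n`. -/
def desNum {n : ℕ} (π : Equiv.Perm (Fin n)) : ℕ :=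
  (Finset.univ.filter fun i : Fin n =>
    ∃ j : Fin n, (j : ℕ) = (i : ℕ) + 1 ∧ π j < π i).card

/-- `invCount n k` is the number of involutions of `{1,…,n}` with exactly `k` descents. -/
def invCount (n k : ℕ) : ℕ :=
  (Finset.univ.filter fun π : Equiv.Perm (Fin n) => π * π = 1 ∧ desNum π = k).card

/-- `fpfInvCount n k` is the number of fixed-point-free involutions of `{1,…,n}`
with exactly `k` descents. -/
def fpfInvCount (n k : ℕ) : ℕ :=
  (Finset.univ.filter fun π : Equiv.Perm (Fin n) =>
    π * π = 1 ∧ (∀ i, π i ≠ i) ∧ desNum π = k).card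

/-- `J_{2n,k}` extended by zero to negative indices `k`. -/
def Jz (n : ℕ) (k : ℤ) : ℤ := if 0 ≤ k then fpfInvCount n k.toNat else 0


/-- `f` is weakly increasing, and `π` increases along the level sets of `f`. -/
def Compat {N m : ℕ} (π : Equiv.Perm (Fin N)) (f : Fin N → Fin m) : Prop :=
  ∀ i j, i < j → f i < f j ∨ (f i = f j ∧ π i < π j)

theorem compat_iff_step {N m : ℕ} (π : Equiv.Perm (Fin (N + 1))) (f : Fin (N + 1) → Fin m) :
    Compat π f ↔ ∀ i : Fin N, f i.castSucc < f i.succ ∨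
      (f i.castSucc = f i.succ ∧ π i.castSucc < π i.succ) := by
  have h : Compat π f ↔ StrictMono (fun i => toLex (f i, π i)) := by
    constructor
    · intro h i j hij
      exact Prod.Lex.toLex_lt_toLex.2 (h i j hij)
    · intro h i j hij
      exact Prod.Lex.toLex_lt_toLex.1 (h hij)
  rw [h, Fin.strictMono_iff_lt_succ]
  simp only [Prod.Lex.toLex_lt_toLex]

/-- position `i` is a descent -/
def dsc {N : ℕ} (π : Equiv.Perm (Fin (N + 1))) (i : ℕ) : Prop :=
  ∃ h : i < N, π (Fin.succ ⟨i, h⟩) < π (Fin.castSucc ⟨i, h⟩)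

open Classical in
theorem desNum_eq_count {N : ℕ} (π : Equiv.Perm (Fin (N + 1))) :
    desNum π = Nat.count (dsc π) N := by
  rw [Nat.count_eq_card_filter_range, desNum]
  refine Finset.card_bij (fun i _ => (i : ℕ)) ?_ ?_ ?_
  · intro i hi
    simp only [Finset.mem_filter, Finset.mem_univ, true_and, Finset.mem_range] at hi ⊢
    obtain ⟨j, hj, hlt⟩ := hi
    have hN : (i : ℕ) < N := by have := j.2; omega
    refine ⟨hN, hN, ?_⟩
    have e1 : Fin.succ ⟨(i : ℕ), hN⟩ = j := by ext; simp [hj]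
    have e2 : Fin.castSucc ⟨(i : ℕ), hN⟩ = i := by ext; simp
    rw [e1, e2]; exact hlt
  · intro a _ b _ h
    exact Fin.ext h
  · intro b hb
    simp only [Finset.mem_filter, Finset.mem_univ, true_and, Finset.mem_range] at hb
    obtain ⟨hN, _, hlt⟩ := hb
    refine ⟨Fin.castSucc ⟨b, hN⟩, ?_, rfl⟩
    simp only [Finset.mem_filter, Finset.mem_univ, true_and]
    exact ⟨Fin.succ ⟨b, hN⟩, rfl, hlt⟩

open Classical in
theorem count_add_count_not (p : ℕ → Prop) (N : ℕ) :
    Nat.count p N + Nat.count (fun i => ¬ p i) N = N := by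
  induction N with
  | zero => simp
  | succ n ih =>
    rw [Nat.count_succ, Nat.count_succ]
    by_cases h : p n <;> simp [h] <;> omega

open Classical in
theorem card_strictMono_fin (a b : ℕ) :
    (Finset.univ.filter fun g : Fin a → Fin b => StrictMono g).card = b.choose a := by
  have h1 : (Finset.univ.filter fun g : Fin a → Fin b => StrictMono g).card
      = (Finset.powersetCard a (Finset.univ : Finset (Fin b))).card := by
    refine Finset.card_bij (fun g _ => Finset.univ.image g) ?_ ?_ ?_
    · intro g hg
      simp only [Finset.mem_filter, Finset.mem_univ, true_and] at hg
      simp [Finset.mem_powersetCard, Finset.card_image_of_injective _ hg.injective]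
    · intro g hg g' hg' h
      simp only [Finset.mem_filter, Finset.mem_univ, true_and] at hg hg'
      have hc : (Finset.univ.image g).card = a := by
        simp [Finset.card_image_of_injective _ hg.injective]
      have e1 := Finset.orderEmbOfFin_unique hc (f := g) (by simp) hg
      have e2 := Finset.orderEmbOfFin_unique hc (f := g') (by
        intro x; rw [h]; simp) hg'
      rw [e1, e2]
    · intro s hs
      rw [Finset.mem_powersetCard] at hs
      refine ⟨s.orderEmbOfFin hs.2, ?_, ?_⟩
      · simp [OrderEmbedding.strictMono]
      · ext x
        have := Finset.range_orderEmbOfFin s hs.2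
        rw [Set.ext_iff] at this
        simpa using this x
  rw [h1, Finset.card_powersetCard]; simp

open Classical in
theorem card_compat {N m : ℕ} (π : Equiv.Perm (Fin (N + 1))) :
    (Finset.univ.filter fun f : Fin (N + 1) → Fin m => Compat π f).card
      = (m + N - desNum π).choose (N + 1) := by
  rw [← card_strictMono_fin]
  set c : ℕ → ℕ := Nat.count (fun i => ¬ dsc π i) with hc
  have hcN : desNum π + c N = N := by
    rw [desNum_eq_count]; exact count_add_count_not _ _
  have hM : m + N - desNum π = m + c N := by omega
  rw [hM]
  have hmono : Monotone c := Nat.count_monotone _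
  have hstep : ∀ i : Fin N, (π i.succ < π i.castSucc ∧ c (i + 1) = c i) ∨
      (π i.castSucc < π i.succ ∧ c (i + 1) = c i + 1) := by
    intro i
    have hd : dsc π i ↔ π i.succ < π i.castSucc := by
      constructor
      · rintro ⟨_, h⟩; exact h
      · intro h; exact ⟨i.2, h⟩
    have hne : π i.succ ≠ π i.castSucc := by
      intro h
      have := π.injective h
      exact absurd this (Fin.castSucc_lt_succ (i := i)).ne'
    rw [hc, Nat.count_succ]
    by_cases h : π i.succ < π i.castSucc
    · left; simp [hd, h]
    · right
      refine ⟨lt_of_le_of_ne (not_lt.1 h) hne.symm, ?_⟩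
      simp only [hd, h, not_false_eq_true, if_true]
  have hcle : ∀ i : Fin (N + 1), c i ≤ c N := fun i => hmono (Nat.lt_succ_iff.1 i.2)
  refine Finset.card_bij (fun f _ => fun i => ⟨(f i : ℕ) + c i, ?_⟩) ?_ ?_ ?_
  · have := hcle i; have := (f i).2; omega
  · intro f hf
    simp only [Finset.mem_filter, Finset.mem_univ, true_and] at hf ⊢
    rw [compat_iff_step] at hf
    rw [Fin.strictMono_iff_lt_succ]
    intro i
    have h1 := hf i
    have h2 := hstep i
    simp only [Fin.lt_def, Fin.ext_iff, Fin.val_castSucc, Fin.val_succ] at h1 h2 ⊢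
    omega
  · intro f _ f' _ h
    funext i
    have := congrFun h i
    simp only [Fin.mk.injEq] at this
    ext; omega
  · intro g hg
    simp only [Finset.mem_filter, Finset.mem_univ, true_and] at hg
    have hg' := hg
    rw [Fin.strictMono_iff_lt_succ] at hg
    -- lower bound
    have hlow : ∀ i : Fin (N + 1), c i ≤ g i := by
      intro i
      induction i using Fin.induction with
      | zero => simp [hc]
      | succ i ih =>
        have h1 := hg i
        have h2 := hstep i
        simp only [Fin.lt_def, Fin.val_castSucc, Fin.val_succ] at h1 h2 ih ⊢
        omega
    have hm : Monotone (fun i : Fin (N + 1) => (g i : ℕ) - c i) := by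
      rw [Fin.monotone_iff_le_succ]
      intro i
      have h1 := hg i
      have h2 := hstep i
      have h3 := hlow i.castSucc
      simp only [Fin.lt_def, Fin.val_castSucc, Fin.val_succ] at h1 h2 h3 ⊢
      omega
    have hlt : ∀ i : Fin (N + 1), (g i : ℕ) - c i < m := by
      intro i
      have h1 := hm (Fin.le_last i)
      have h2 := (g (Fin.last N)).2
      have h3 := hlow (Fin.last N)
      simp only [Fin.val_last] at h1 h2 h3
      omega
    refine ⟨fun i => ⟨(g i : ℕ) - c i, hlt i⟩, ?_, ?_⟩
    · simp only [Finset.mem_filter, Finset.mem_univ, true_and]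
      rw [compat_iff_step]
      intro i
      have h1 := hg i
      have h2 := hstep i
      have h3 := hlow i.castSucc
      have h4 := hlow i.succ
      simp only [Fin.lt_def, Fin.ext_iff, Fin.val_castSucc, Fin.val_succ] at h1 h2 h3 h4 ⊢
      omega
    · funext i
      ext
      have := hlow i
      simp only
      omega

theorem mono_unique {N m : ℕ} {w w' : Fin N → Fin m × Fin m}
    (h : Monotone fun i => toLex (w i)) (h' : Monotone fun i => toLex (w' i))
    (e : (Finset.univ : Finset (Fin N)).val.map w = (Finset.univ : Finset (Fin N)).val.map w') :
    w = w' := by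
  have e2 := congrArg (Multiset.map toLex) e
  rw [Multiset.map_map, Multiset.map_map, Fin.univ_val_map, Fin.univ_val_map,
    Multiset.coe_eq_coe] at e2
  have e3 := List.ofFn_injective
    (e2.eq_of_pairwise' (Monotone.sortedLE_ofFn h).pairwise (Monotone.sortedLE_ofFn h').pairwise)
  funext i
  exact toLex.injective (congrFun e3 i)

theorem inv_apply_apply {N : ℕ} {π : Equiv.Perm (Fin N)} (h : π * π = 1) (i : Fin N) :
    π (π i) = i := by
  have := congrArg (fun σ => σ i) h
  simpa using this

theorem fwd_ne {N m : ℕ} {π : Equiv.Perm (Fin N)} {f : Fin N → Fin m}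
    (h : π * π = 1) (hf : ∀ i, π i ≠ i) (hc : Compat π f) (i : Fin N) : f i ≠ f (π i) := by
  intro he
  have hi := inv_apply_apply h i
  rcases lt_or_gt_of_ne (hf i) with hlt | hlt
  · have := hc _ _ hlt
    rw [hi] at this
    rcases this with h1 | h1
    · exact absurd he h1.ne'
    · exact absurd hlt h1.2.asymm
  · have := hc _ _ hlt
    rw [hi] at this
    rcases this with h1 | h1
    · exact absurd he h1.ne
    · exact absurd hlt h1.2.asymm

theorem compat_mono {N m : ℕ} {π : Equiv.Perm (Fin N)} {f : Fin N → Fin m}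
    (hc : Compat π f) : Monotone f := by
  intro i j hij
  rcases hij.eq_or_lt with h | h
  · rw [h]
  · rcases hc i j h with h1 | h1
    · exact h1.le
    · exact h1.1.le

theorem fwd_mono {N m : ℕ} {π : Equiv.Perm (Fin N)} {f : Fin N → Fin m}
    (hc : Compat π f) : Monotone fun i => toLex (f i, f (π i)) := by
  intro i j hij
  rcases hij.eq_or_lt with h | h
  · rw [h]
  · rw [Prod.Lex.toLex_le_toLex]
    rcases hc i j h with h1 | h1
    · exact Or.inl h1
    · exact Or.inr ⟨h1.1, compat_mono hc h1.2.le⟩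

theorem fwd_sort {N m : ℕ} {π : Equiv.Perm (Fin N)} {f : Fin N → Fin m}
    (h : π * π = 1) (hc : Compat π f) :
    π = Tuple.sort (fun i => toLex (f (π i), f i)) := by
  rw [Tuple.eq_sort_iff]
  constructor
  · have := fwd_mono hc
    have e : (fun i => toLex (f (π i), f i)) ∘ π = fun i => toLex (f i, f (π i)) := by
      funext i
      simp [inv_apply_apply h]
    rw [e]; exact this
  · intro i j hij he
    simp only [inv_apply_apply h, EmbeddingLike.apply_eq_iff_eq, Prod.mk.injEq] at he
    rcases hc i j hij with h1 | h1
    · exact absurd he.1 h1.ne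
    · exact h1.2

theorem bwd {N m : ℕ} (w : Fin N → Fin m × Fin m) (hw : Monotone fun i => toLex (w i))
    (hs : (Finset.univ : Finset (Fin N)).val.map (fun i => (w i).swap)
      = (Finset.univ : Finset (Fin N)).val.map w)
    (hne : ∀ i, (w i).1 ≠ (w i).2) :
    ∃ (π : Equiv.Perm (Fin N)) (f : Fin N → Fin m), π * π = 1 ∧ (∀ i, π i ≠ i) ∧ Compat π f ∧
      w = fun i => (f i, f (π i)) := by
  set g : Fin N → Fin m ×ₗ Fin m := fun i => toLex (w i).swap with hg
  obtain ⟨π, hπ⟩ : ∃ π, π = Tuple.sort g := ⟨_, rfl⟩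
  obtain ⟨hm, hst⟩ := Tuple.eq_sort_iff.1 hπ
  have h1 : (fun i => (w (π i)).swap) = w := by
    apply mono_unique hm hw
    rw [← hs]
    conv_rhs => rw [← Multiset.map_univ_val_equiv π, Multiset.map_map]
    rfl
  have h1' : ∀ i, (w (π i)).swap = w i := fun i => congrFun h1 i
  have h2 : ∀ i, w (π i) = (w i).swap := fun i => by rw [← h1' i, Prod.swap_swap]
  have hst' : ∀ i j, i < j → w i = w j → π i < π j := by
    intro i j hij he
    apply hst i j hij
    simp only [hg, h1', he]
  have hpi : ∀ i, π (π⁻¹ i) = i := fun i => π.apply_symm_apply i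
  have hinv : π⁻¹ = π := by
    refine Eq.trans (Tuple.eq_sort_iff.2 ?_) hπ.symm
    have h3 : ∀ i, g (π⁻¹ i) = toLex (w i) := by
      intro i
      simp only [hg]
      rw [← h2]; simp
    constructor
    · intro i j hij
      simp only [Function.comp, h3]
      exact hw hij
    · intro i j hij he
      rw [h3, h3] at he
      have he' : w i = w j := he
      by_contra hlt
      have hlt : π⁻¹ j < π⁻¹ i := by
        refine lt_of_le_of_ne (not_lt.1 hlt) ?_
        intro h; exact hij.ne' (π⁻¹.injective h)
      have := hst' _ _ hlt (by
        have a1 := h1' (π⁻¹ i)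
        have a2 := h1' (π⁻¹ j)
        rw [hpi] at a1 a2
        rw [← a1, ← a2, he'])
      rw [hpi, hpi] at this
      exact absurd hij this.asymm
  have hpp : π * π = 1 := by
    nth_rewrite 1 [← hinv]; simp
  refine ⟨π, fun i => (w i).1, hpp, ?_, ?_, ?_⟩
  · intro i hi
    have := h2 i
    rw [hi] at this
    exact hne i (by rw [Prod.ext_iff] at this; exact this.1)
  · intro i j hij
    have h3 := hw hij.le
    simp only at h3
    rw [Prod.Lex.toLex_le_toLex] at h3
    rcases h3 with h3 | ⟨h3, h4⟩
    · exact Or.inl h3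
    · refine Or.inr ⟨h3, ?_⟩
      rcases h4.eq_or_lt with h5 | h5
      · exact hst' i j hij (Prod.ext h3 h5)
      · by_contra hlt
        have h6 := hw (not_lt.1 hlt)
        simp only [h2] at h6
        rw [Prod.Lex.toLex_le_toLex] at h6
        simp only [Prod.fst_swap, Prod.snd_swap] at h6
        rcases h6 with h6 | h6
        · exact absurd h5 h6.asymm
        · exact absurd h6.1 h5.ne'
  · funext i
    simp [h2]

theorem sym_split {m : ℕ} (M : Multiset (Fin m × Fin m)) (hs : M.map Prod.swap = M)
    (hne : ∀ p ∈ M, p.1 ≠ p.2) :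
    M = M.filter (fun p => p.1 < p.2) + (M.filter (fun p => p.1 < p.2)).map Prod.swap := by
  have h1 : (M.filter (fun p => p.1 < p.2)).map Prod.swap = M.filter (fun p => ¬ p.1 < p.2) := by
    conv_rhs => rw [← hs]
    rw [Multiset.filter_map]
    congr 1
    apply Multiset.filter_congr
    intro p hp
    have := hne p hp
    simp only [Function.comp, Prod.fst_swap, Prod.snd_swap]
    constructor
    · intro h; exact h.asymm
    · intro h; exact lt_of_le_of_ne (not_lt.1 h) this
  rw [h1, Multiset.filter_add_not]

theorem filter_split {m : ℕ} (S : Multiset (Fin m × Fin m)) (hS : ∀ p ∈ S, p.1 < p.2) :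
    (S + S.map Prod.swap).filter (fun p => p.1 < p.2) = S := by
  rw [Multiset.filter_add, Multiset.filter_eq_self.2 hS]
  have : (S.map Prod.swap).filter (fun p => p.1 < p.2) = 0 := by
    rw [Multiset.filter_eq_nil]
    intro p hp
    obtain ⟨q, hq, rfl⟩ := Multiset.mem_map.1 hp
    exact (hS q hq).asymm
  rw [this, add_zero]

theorem exists_mono_enum {m N : ℕ} (M : Multiset (Fin m × Fin m)) (hM : M.card = N) :
    ∃ w : Fin N → Fin m × Fin m, (Monotone fun i => toLex (w i)) ∧
      (Finset.univ : Finset (Fin N)).val.map w = M := by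
  subst hM
  obtain ⟨l, rfl⟩ := Quot.exists_rep M
  have hl : Multiset.card (Quot.mk _ l : Multiset (Fin m × Fin m)) = l.length := rfl
  rw [hl]
  let w0 : Fin l.length → Fin m × Fin m := l.get
  refine ⟨w0 ∘ Tuple.sort (fun i => toLex (w0 i)), Tuple.monotone_sort (fun i => toLex (w0 i)), ?_⟩
  rw [← Multiset.map_map, Multiset.map_univ_val_equiv, Fin.univ_val_map]
  simp [w0]

/-- the multiset of pairs attached to `(π, f)` -/
def pairs {N m : ℕ} (π : Equiv.Perm (Fin N)) (f : Fin N → Fin m) : Multiset (Fin m × Fin m) :=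
  (Finset.univ : Finset (Fin N)).val.map (fun i => (f i, f (π i)))

theorem pairs_swap {N m : ℕ} {π : Equiv.Perm (Fin N)} {f : Fin N → Fin m} (h : π * π = 1) :
    (pairs π f).map Prod.swap = pairs π f := by
  rw [pairs]
  conv_rhs => rw [← Multiset.map_univ_val_equiv π]
  rw [Multiset.map_map, Multiset.map_map]
  congr 1
  funext i
  simp [inv_apply_apply h]

theorem pairs_ne {N m : ℕ} {π : Equiv.Perm (Fin N)} {f : Fin N → Fin m}
    (h : π * π = 1) (hf : ∀ i, π i ≠ i) (hc : Compat π f) : ∀ p ∈ pairs π f, p.1 ≠ p.2 := by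
  intro p hp
  obtain ⟨i, _, rfl⟩ := Multiset.mem_map.1 hp
  exact fwd_ne h hf hc i

/-- the finset of admissible pairs `(π, f)` -/
noncomputable def adm (N m : ℕ) : Finset (Equiv.Perm (Fin N) × (Fin N → Fin m)) := by
  classical
  exact Finset.univ.filter fun x => (x.1 * x.1 = 1 ∧ ∀ i, x.1 i ≠ i) ∧ Compat x.1 x.2

theorem mem_adm {N m : ℕ} (x : Equiv.Perm (Fin N) × (Fin N → Fin m)) :
    x ∈ adm N m ↔ (x.1 * x.1 = 1 ∧ ∀ i, x.1 i ≠ i) ∧ Compat x.1 x.2 := by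
  classical
  simp [adm]

theorem card_adm (n m : ℕ) :
    (adm (2 * n) m).card =
      ((Finset.univ.filter fun p : Fin m × Fin m => p.1 < p.2).sym n).card := by
  refine Finset.card_bij
    (fun x hx => ⟨(pairs x.1 x.2).filter (fun p => p.1 < p.2), ?_⟩) ?_ ?_ ?_
  · rw [mem_adm] at hx
    obtain ⟨⟨h, hf⟩, hc⟩ := hx
    have := congrArg Multiset.card (sym_split _ (pairs_swap h) (pairs_ne h hf hc))
    rw [Multiset.card_add, Multiset.card_map] at this
    have h2 : (pairs x.1 x.2).card = 2 * n := by simp [pairs]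
    omega
  · intro x hx
    refine Finset.mem_sym_iff.2 ?_
    intro a ha
    have ha : a ∈ (pairs x.1 x.2).filter (fun p => p.1 < p.2) := ha
    simpa using (Multiset.mem_filter.1 ha).2
  · rintro ⟨π, f⟩ hx ⟨π', f'⟩ hx' he
    rw [mem_adm] at hx hx'
    simp only at hx hx'
    obtain ⟨⟨h, hf⟩, hc⟩ := hx
    obtain ⟨⟨h', hf'⟩, hc'⟩ := hx'
    have he := congrArg Subtype.val he
    simp only at he
    have hp : pairs π f = pairs π' f' := by
      rw [sym_split _ (pairs_swap h) (pairs_ne h hf hc),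
        sym_split _ (pairs_swap h') (pairs_ne h' hf' hc'), he]
    have hw := mono_unique (fwd_mono hc) (fwd_mono hc') hp
    have h1 : ∀ i, f i = f' i := fun i => congrArg Prod.fst (congrFun hw i)
    have h2 : ∀ i, f (π i) = f' (π' i) := fun i => congrArg Prod.snd (congrFun hw i)
    have hππ : π = π' := by
      rw [fwd_sort h hc, fwd_sort h' hc']
      congr 1
      funext i
      rw [h2, h1]
    rw [hππ, funext h1]
  · intro S hS
    rw [Finset.mem_sym_iff] at hS
    obtain ⟨S, hcard⟩ := S
    have hS : ∀ p ∈ S, p.1 < p.2 := by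
      intro p hp
      simpa using hS p hp
    obtain ⟨w, hw, hM⟩ := exists_mono_enum (N := 2 * n) (S + S.map Prod.swap) (by
      rw [Multiset.card_add, Multiset.card_map]; omega)
    obtain ⟨π, f, h, hf, hc, hwf⟩ := bwd w hw (by
      have : (Finset.univ : Finset (Fin (2 * n))).val.map (fun i => (w i).swap)
          = ((Finset.univ : Finset (Fin (2 * n))).val.map w).map Prod.swap := by
        rw [Multiset.map_map]; rfl
      rw [this, hM, Multiset.map_add, Multiset.map_map, Prod.swap_swap_eq, Multiset.map_id,
        add_comm]) (by
      intro i
      have : w i ∈ S + S.map Prod.swap := by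
        rw [← hM]; exact Multiset.mem_map.2 ⟨i, Finset.mem_univ i, rfl⟩
      rcases Multiset.mem_add.1 this with h | h
      · exact (hS _ h).ne
      · obtain ⟨q, hq, hqe⟩ := Multiset.mem_map.1 h
        rw [← hqe]
        exact (hS q hq).ne')
    refine ⟨(π, f), ?_, ?_⟩
    · rw [mem_adm]
      exact ⟨⟨h, hf⟩, hc⟩
    · apply Subtype.ext
      simp only
      have : pairs π f = S + S.map Prod.swap := by rw [← hM, hwf]; rfl
      rw [this, filter_split S hS]

theorem card_sym_finset {α : Type*} [DecidableEq α] (s : Finset α) (n : ℕ) :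
    (s.sym n).card = s.card.multichoose n := by
  rw [← Fintype.card_coe s, ← Sym.card_sym_eq_multichoose, ← Finset.card_univ, eq_comm]
  refine Finset.card_bij (fun S _ => S.map Subtype.val) ?_ ?_ ?_
  · intro S _
    rw [Finset.mem_sym_iff]
    intro a ha
    obtain ⟨b, _, rfl⟩ := Sym.mem_map.1 ha
    exact b.2
  · intro a _ b _ h
    exact Sym.map_injective Subtype.val_injective n h
  · intro S hS
    rw [Finset.mem_sym_iff] at hS
    obtain ⟨S, hc⟩ := S
    have hS : ∀ p ∈ S, p ∈ s := hS
    lift S to Multiset s using hS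
    refine ⟨⟨S, by simpa using hc⟩, Finset.mem_univ _, ?_⟩
    rfl

theorem card_lt_pairs (m : ℕ) :
    (Finset.univ.filter fun p : Fin m × Fin m => p.1 < p.2).card = m.choose 2 := by
  classical
  rw [← card_strictMono_fin 2 m, eq_comm]
  refine Finset.card_bij (fun g _ => (g 0, g 1)) ?_ ?_ ?_
  · intro g hg
    simp only [Finset.mem_filter, Finset.mem_univ, true_and] at hg ⊢
    exact hg (by decide)
  · intro g _ g' _ h
    simp only [Prod.mk.injEq] at h
    funext i
    fin_cases i
    · exact h.1
    · exact h.2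
  · rintro ⟨a, b⟩ h
    simp only [Finset.mem_filter, Finset.mem_univ, true_and] at h
    refine ⟨![a, b], ?_, rfl⟩
    simp only [Finset.mem_filter, Finset.mem_univ, true_and]
    rw [Fin.strictMono_iff_lt_succ]
    intro i
    fin_cases i
    exact h

/-- fixed-point-free involutions -/
def fpf (N : ℕ) : Finset (Equiv.Perm (Fin N)) :=
  Finset.univ.filter fun π => π * π = 1 ∧ ∀ i, π i ≠ i

theorem sum_fpf (n m : ℕ) :
    ∑ π ∈ fpf (2 * (n + 1)), (m + (2 * n + 1) - desNum π).choose (2 * n + 2)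
      = (m.choose 2).multichoose (n + 1) := by
  classical
  rw [← card_lt_pairs, ← card_sym_finset, ← card_adm]
  have h2 : ∀ π : Equiv.Perm (Fin (2 * (n + 1))), (m + (2 * n + 1) - desNum π).choose (2 * n + 2)
      = (Finset.univ.filter fun f : Fin (2 * (n + 1)) → Fin m => Compat π f).card := fun π =>
    (card_compat (N := 2 * n + 1) π).symm
  simp only [h2]
  rw [← Finset.card_sigma]
  refine Finset.card_bij (fun x _ => (x.1, x.2)) ?_ ?_ ?_
  · rintro ⟨π, f⟩ h
    simpa [mem_adm, fpf] using h
  · rintro ⟨π, f⟩ _ ⟨π', f'⟩ _ h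
    simpa using h
  · rintro ⟨π, f⟩ h
    exact ⟨⟨π, f⟩, by simpa [mem_adm, fpf] using h, rfl⟩

theorem sum_J (n m K : ℕ) (hK : 2 * n + 2 ≤ K) :
    ∑ k ∈ Finset.range K, fpfInvCount (2 * (n + 1)) k * (m + (2 * n + 1) - k).choose (2 * n + 2)
      = (m.choose 2).multichoose (n + 1) := by
  rw [← sum_fpf]
  have hd : ∀ π ∈ fpf (2 * (n + 1)), desNum π ∈ Finset.range K := by
    intro π _
    have h1 : desNum π ≤ 2 * n + 1 := by
      classical
      have h := desNum_eq_count (N := 2 * n + 1) π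
      have h' := Nat.count_le (p := dsc (N := 2 * n + 1) π) (n := 2 * n + 1)
      exact h.le.trans h'
    rw [Finset.mem_range]; omega
  rw [← Finset.sum_fiberwise_of_maps_to hd]
  apply Finset.sum_congr rfl
  intro k _
  rw [Finset.sum_congr rfl (g := fun _ => (m + (2 * n + 1) - k).choose (2 * n + 2))]
  · rw [Finset.sum_const, smul_eq_mul]
    congr 1
    rw [fpfInvCount, fpf, Finset.filter_filter]
    congr 1
    apply Finset.filter_congr
    intro π _
    rw [and_assoc]
  · intro π hπ
    rw [(Finset.mem_filter.1 hπ).2]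

theorem J_zero (n k : ℕ) (hk : 2 * n + 2 ≤ k) : fpfInvCount (2 * (n + 1)) k = 0 := by
  rw [fpfInvCount, Finset.card_eq_zero, Finset.filter_eq_empty_iff]
  rintro π - ⟨_, _, hd⟩
  classical
  have h := desNum_eq_count (N := 2 * n + 1) π
  have h' := Nat.count_le (p := dsc (N := 2 * n + 1) π) (n := 2 * n + 1)
  have : desNum π ≤ 2 * n + 1 := h.le.trans h'
  omega

theorem choose_right_int (n k : ℕ) :
    ((n.choose (k + 1) : ℕ) : ℤ) * ((k : ℤ) + 1) = (n.choose k : ℕ) * ((n : ℤ) - k) := by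
  rcases le_or_gt k n with h | h
  · have := Nat.choose_succ_right_eq n k
    zify [h] at this
    exact this
  · rw [Nat.choose_eq_zero_of_lt h, Nat.choose_eq_zero_of_lt (by omega)]; simp

theorem choose_up_int (n k : ℕ) :
    (((n + 1).choose (k + 1) : ℕ) : ℤ) * ((k : ℤ) + 1) = ((n : ℤ) + 1) * (n.choose k : ℕ) := by
  have := Nat.add_one_mul_choose_eq n k
  zify at this
  exact this.symm

theorem expand_aux (N x : ℕ) (k m : ℤ) (hm : m = (x : ℤ) - N + 1 + k) :
    (m * (m - 1) + N) * (x.choose N : ℕ)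
      = (k * (k + 1) + N) * ((x + 2).choose (N + 2) : ℕ)
        + 2 * (k * (N - k) + 1) * ((x + 1).choose (N + 2) : ℕ)
        + ((N - k) * (N - k + 1) + N) * (x.choose (N + 2) : ℕ) := by
  have a1 := choose_right_int x N
  have a2 := choose_right_int x (N + 1)
  have b1 := choose_up_int x (N + 1)
  have c1 := choose_up_int (x + 1) (N + 1)
  have c2 := choose_up_int x N
  have hpos : ((N : ℤ) + 1) * ((N : ℤ) + 2) ≠ 0 := by positivity
  push_cast at a1 a2 b1 c1 c2
  subst hm
  apply mul_left_cancel₀ hpos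
  have A : ((N : ℤ) + 1) * ((N : ℤ) + 2) * (x.choose (N + 2) : ℕ)
      = (x.choose N : ℕ) * ((x : ℤ) - N) * (x - N - 1) := by
    linear_combination ((N : ℤ) + 1) * a2 + ((x : ℤ) - N - 1) * a1
  have B : ((N : ℤ) + 1) * ((N : ℤ) + 2) * ((x + 1).choose (N + 2) : ℕ)
      = ((x : ℤ) + 1) * ((x.choose N : ℕ) * ((x : ℤ) - N)) := by
    linear_combination ((N : ℤ) + 1) * b1 + ((x : ℤ) + 1) * a1
  have C : ((N : ℤ) + 1) * ((N : ℤ) + 2) * ((x + 2).choose (N + 2) : ℕ)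
      = ((x : ℤ) + 2) * ((x + 1) * (x.choose N : ℕ)) := by
    linear_combination ((N : ℤ) + 1) * c1 + ((x : ℤ) + 2) * c2
  linear_combination (-(k * (k + 1) + N)) * C - (2 * (k * (N - k) + 1)) * B
    - ((N - k) * (N - k + 1) + N) * A

/-- expansion in terms of `choose (m + (N+1) - j) (N+2)`, with truncated subtraction -/
theorem expand (N k m : ℕ) (hN : 1 ≤ N) :
    ((m : ℤ) * (m - 1) + N) * ((m + (N - 1) - k).choose N : ℕ)
      = ((k : ℤ) * (k + 1) + N) * ((m + (N + 1) - k).choose (N + 2) : ℕ)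
        + 2 * ((k : ℤ) * (N - k) + 1) * ((m + (N + 1) - (k + 1)).choose (N + 2) : ℕ)
        + (((N : ℤ) - k) * (N - k + 1) + N) * ((m + (N + 1) - (k + 2)).choose (N + 2) : ℕ) := by
  rcases le_or_gt k (m + (N - 1)) with h | h
  · obtain ⟨x, hx⟩ := Nat.exists_eq_add_of_le h
    have e0 : m + (N - 1) - k = x := by omega
    have e1 : m + (N + 1) - k = x + 2 := by omega
    have e2 : m + (N + 1) - (k + 1) = x + 1 := by omega
    have e3 : m + (N + 1) - (k + 2) = x := by omega
    rw [e0, e1, e2, e3]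
    apply expand_aux
    omega
  · rw [Nat.choose_eq_zero_of_lt (by omega), Nat.choose_eq_zero_of_lt (by omega),
      Nat.choose_eq_zero_of_lt (by omega), Nat.choose_eq_zero_of_lt (by omega)]
    simp

theorem multichoose_rec (M n : ℕ) :
    (n + 1) * M.multichoose (n + 1) = (M + n) * M.multichoose n := by
  rcases M with _ | M
  · rcases n with _ | n <;> simp
  · rw [Nat.multichoose_eq, Nat.multichoose_eq]
    have e1 : M + 1 + (n + 1) - 1 = M + n + 1 := by omega
    have e2 : M + 1 + n - 1 = M + n := by omega
    rw [e1, e2]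
    have := Nat.add_one_mul_choose_eq (M + n) n
    linarith

theorem two_choose (m : ℕ) : 2 * ((m.choose 2 : ℕ) : ℤ) = (m : ℤ) * (m - 1) := by
  have := choose_right_int m 1
  simp at this
  linarith

theorem unitri (N : ℕ) (D : ℕ → ℤ) (K : ℕ)
    (h : ∀ m : ℕ, ∑ k ∈ Finset.range K, D k * ((m + (N + 1) - k).choose (N + 2) : ℕ) = 0) :
    ∀ k < K, D k = 0 := by
  intro k
  induction k using Nat.strong_induction_on with
  | _ k ih =>
    intro hk
    have h1 := h (k + 1)
    rw [Finset.sum_eq_single k] at h1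
    · have e : k + 1 + (N + 1) - k = N + 2 := by omega
      rw [e] at h1
      simpa using h1
    · intro j hj hjk
      rcases lt_or_gt_of_ne hjk with hlt | hlt
      · rw [ih j hlt (by omega)]; simp
      · rw [Nat.choose_eq_zero_of_lt (by omega)]; simp
    · intro h2
      exact absurd (Finset.mem_range.2 hk) h2

theorem Jz_cast (N k : ℕ) : Jz N (k : ℤ) = fpfInvCount N k := by
  simp [Jz]

theorem Jz_neg (N : ℕ) (k : ℤ) (hk : k < 0) : Jz N k = 0 := by
  simp [Jz, hk]

/-- Recurrence in shifted form. -/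
theorem rec_aux (n K : ℕ) (hK : 2 * n + 4 ≤ K) : ∀ k < K + 2,
    (2 * (n : ℤ) + 4) * Jz (2 * (n + 1 + 1)) k
      - (((k : ℤ) * (k + 1) + (2 * n + 2)) * Jz (2 * (n + 1)) k
        + 2 * (((k : ℤ) - 1) * ((2 * n + 2) - (k - 1)) + 1) * Jz (2 * (n + 1)) ((k : ℤ) - 1)
        + (((2 * n + 2) - ((k : ℤ) - 2)) * ((2 * n + 2) - (k - 2) + 1) + (2 * n + 2))
          * Jz (2 * (n + 1)) ((k : ℤ) - 2)) = 0 := by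
  apply unitri (2 * n + 2)
  intro m
  set c : ℕ → ℤ := fun k => (((m + (2 * n + 2 + 1) - k).choose (2 * n + 2 + 2) : ℕ) : ℤ) with hc
  set J : ℕ → ℤ := fun k => ((fpfInvCount (2 * (n + 1)) k : ℕ) : ℤ) with hJ
  have hbig := sum_J (n + 1) m (K + 2) (by omega)
  have hsmall := sum_J n m K (by omega)
  have hmc := multichoose_rec (m.choose 2) (n + 1)
  have h2 := two_choose m
  zify at hbig hsmall hmc
  have s0 : ∑ k ∈ Finset.range (K + 2), (2 * (n : ℤ) + 4) * Jz (2 * (n + 1 + 1)) k * c k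
      = (2 * (n : ℤ) + 4) * (((m.choose 2).multichoose (n + 1 + 1) : ℕ) : ℤ) := by
    rw [← hbig, Finset.mul_sum]
    apply Finset.sum_congr rfl
    intro k _
    rw [Jz_cast, mul_assoc]
    rfl
  have z : ∀ k, K ≤ k → J k = 0 := by
    intro k hk
    simp only [hJ]
    rw [J_zero n k (by omega)]; rfl
  have s1 : ∑ k ∈ Finset.range (K + 2), ((k : ℤ) * (k + 1) + (2 * n + 2)) * Jz (2 * (n + 1)) k * c k
      = ∑ k ∈ Finset.range K, J k * (((k : ℤ) * (k + 1) + (2 * n + 2)) * c k) := by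
    rw [Finset.sum_range_succ, Finset.sum_range_succ, Jz_cast, Jz_cast]
    have z1 := z K le_rfl
    have z2 := z (K + 1) (by omega)
    simp only [hJ] at z1 z2
    rw [z1, z2]
    simp only [mul_zero, zero_mul, add_zero]
    apply Finset.sum_congr rfl
    intro k _
    rw [Jz_cast]; ring
  have s2 : ∑ k ∈ Finset.range (K + 2),
      2 * (((k : ℤ) - 1) * ((2 * n + 2) - (k - 1)) + 1) * Jz (2 * (n + 1)) ((k : ℤ) - 1) * c k
      = ∑ k ∈ Finset.range K, J k * (2 * ((k : ℤ) * ((2 * n + 2) - k) + 1) * c (k + 1)) := by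
    rw [Finset.sum_range_succ', Jz_neg _ _ (by norm_num), Finset.sum_range_succ]
    have e : ∀ k : ℕ, ((k + 1 : ℕ) : ℤ) - 1 = k := by intro k; push_cast; ring
    simp only [e, Jz_cast]
    have z1 := z K le_rfl
    simp only [hJ] at z1
    rw [z1]
    simp only [mul_zero, zero_mul, add_zero]
    apply Finset.sum_congr rfl
    intro k _
    simp only [hJ]; ring
  have s3 : ∑ k ∈ Finset.range (K + 2),
      (((2 * n + 2) - ((k : ℤ) - 2)) * ((2 * n + 2) - (k - 2) + 1) + (2 * n + 2))
          * Jz (2 * (n + 1)) ((k : ℤ) - 2) * c k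
      = ∑ k ∈ Finset.range K,
        J k * ((((2 * n + 2) - (k : ℤ)) * ((2 * n + 2) - k + 1) + (2 * n + 2)) * c (k + 2)) := by
    rw [Finset.sum_range_succ', Jz_neg _ _ (by norm_num), Finset.sum_range_succ',
      Jz_neg _ _ (by norm_num)]
    have e : ∀ k : ℕ, ((k + 1 + 1 : ℕ) : ℤ) - 2 = k := by intro k; push_cast; ring
    simp only [e, Jz_cast]
    simp only [mul_zero, zero_mul, add_zero]
    apply Finset.sum_congr rfl
    intro k _
    simp only [hJ]; ring
  have s4 : ((m : ℤ) * (m - 1) + (2 * n + 2)) * (((m.choose 2).multichoose (n + 1) : ℕ) : ℤ)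
      = ∑ k ∈ Finset.range K, J k * (((k : ℤ) * (k + 1) + (2 * n + 2)) * c k)
      + ∑ k ∈ Finset.range K, J k * (2 * ((k : ℤ) * ((2 * n + 2) - k) + 1) * c (k + 1))
      + ∑ k ∈ Finset.range K,
        J k * ((((2 * n + 2) - (k : ℤ)) * ((2 * n + 2) - k + 1) + (2 * n + 2)) * c (k + 2)) := by
    rw [← hsmall, Finset.mul_sum, ← Finset.sum_add_distrib, ← Finset.sum_add_distrib]
    apply Finset.sum_congr rfl
    intro k _
    have := expand (2 * n + 2) k m (by omega)
    have e : 2 * n + 2 - 1 = 2 * n + 1 := by omega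
    rw [e] at this
    push_cast at this
    simp only [hc, hJ]
    linear_combination ((fpfInvCount (2 * (n + 1)) k : ℕ) : ℤ) * this
  change ∑ k ∈ Finset.range (K + 2), (_ - (_ + _ + _)) * c k = 0
  simp_rw [sub_mul _ _ (c _)]
  rw [Finset.sum_sub_distrib, s0]
  simp_rw [add_mul _ _ (c _)]
  rw [Finset.sum_add_distrib, Finset.sum_add_distrib, s1, s2, s3]
  linear_combination s4 + 2 * hmc
    + (((m.choose 2).multichoose (n + 1) : ℕ) : ℤ) * h2

/-- Recurrence for the numbers `J_{2n,k}`. -/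
theorem J_recurrence (n : ℕ) (hn : 2 ≤ n) (k : ℕ) :
    2 * (n : ℤ) * Jz (2 * n) k
      = ((k : ℤ) * (k + 1) + 2 * n - 2) * Jz (2 * n - 2) k
        + 2 * (((k : ℤ) - 1) * (2 * n - k - 1) + 1) * Jz (2 * n - 2) ((k : ℤ) - 1)
        + ((2 * (n : ℤ) - k) * (2 * n - k + 1) + 2 * n - 2) * Jz (2 * n - 2) ((k : ℤ) - 2) := by
  obtain ⟨n, rfl⟩ := Nat.exists_eq_add_of_le' hn
  have h := rec_aux n (2 * n + 4 + k) (by omega) k (by omega)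
  have e : 2 * (n + 2) - 2 = 2 * (n + 1) := by omega
  rw [e]
  push_cast
  have e2 : 2 * (n + 1 + 1) = 2 * (n + 2) := by omega
  rw [e2] at h
  linear_combination h
end

section
/- For n ≥ 3 and k ≥ 0, the numbers I_{n,k} satisfy the recurrence n·I_{n,k} = (k+1) I_{n-1,k} + (n-k) I_{n-1,k-1} + [(k+1)² + n - 2] I_{n-2,k} + [2k(n-k-1) - n + 3] I_{n-2,k-1} + [(n-k)² + n - 2] I_{n-2,k-2}, with the convention I_{n,k} = 0 for k < 0. -/
open Finset Polynomial

/-- `I_{n,k}` extended by zero to negative indices `k`. -/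
def Iz (n : ℕ) (k : ℤ) : ℤ := if 0 ≤ k then invCount n k.toNat else 0

namespace IR

lemma exists_perm_of_card {β : Type*} [DecidableEq β] {n : ℕ} (f g : Fin n → β)
    (h : ∀ x, (univ.filter fun i => f i = x).card = (univ.filter fun i => g i = x).card) :
    ∃ σ : Equiv.Perm (Fin n), f = g ∘ σ := by
  have h' : ∀ x, Nonempty ({i // f i = x} ≃ {i // g i = x}) := fun x => by
    apply Fintype.card_eq.1
    rw [Fintype.card_subtype, Fintype.card_subtype]; exact h x
  let e : ∀ x, ({i // f i = x} ≃ {i // g i = x}) := fun x => (h' x).some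
  refine ⟨(Equiv.sigmaFiberEquiv f).symm.trans
    ((Equiv.sigmaCongrRight e).trans (Equiv.sigmaFiberEquiv g)), ?_⟩
  funext i
  simp only [Function.comp, Equiv.trans_apply]
  exact ((e (f i)) ⟨i, rfl⟩).2.symm

lemma mono_unique {β : Type*} [LinearOrder β] {n : ℕ} (f g : Fin n → β)
    (hf : Monotone f) (hg : Monotone g)
    (h : ∀ x, (univ.filter fun i => f i = x).card = (univ.filter fun i => g i = x).card) :
    f = g := by
  obtain ⟨σ, hσ⟩ := exists_perm_of_card f g h
  have := Tuple.unique_monotone (f := g) (σ := σ) (τ := 1) (hσ ▸ hf) (by simpa using hg)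
  rw [hσ, this]; rfl

lemma mono_exists {β : Type*} [LinearOrder β] [Fintype β] {n : ℕ} (M : β → ℕ)
    (hM : ∑ x, M x = n) :
    ∃ f : Fin n → β, Monotone f ∧ ∀ x, (univ.filter fun i => f i = x).card = M x := by
  have e : (Σ x, Fin (M x)) ≃ Fin n := Fintype.equivFinOfCardEq (by simp [hM])
  let f0 : Fin n → β := fun i => (e.symm i).1
  refine ⟨f0 ∘ Tuple.sort f0, Tuple.monotone_sort f0, fun x => ?_⟩
  rw [← Fintype.card_fin (M x), ← Fintype.card_subtype]
  apply Fintype.card_congr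
  refine Equiv.trans (Equiv.subtypeEquiv (q := fun y : Σ x, Fin (M x) => y.1 = x)
    ((Tuple.sort f0).trans e.symm) (by intro a; simp [f0])) ?_
  exact Equiv.sigmaSubtype (α := β) (β := fun x => Fin (M x)) x

/-- compatible pairs -/
def Good {n m : ℕ} (π : Equiv.Perm (Fin n)) (a : Fin n → Fin m) : Prop :=
  StrictMono fun i => toLex (a i, π i)

lemma good_iff {n m : ℕ} (π : Equiv.Perm (Fin n)) (a : Fin n → Fin m) :
    Good π a ↔ Monotone a ∧ ∀ i j, i < j → a i = a j → π i < π j := by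
  constructor
  · intro h
    refine ⟨fun i j hij => ?_, fun i j hij he => ?_⟩
    · rcases hij.eq_or_lt with rfl | hl
      · exact le_rfl
      · rcases Prod.Lex.toLex_lt_toLex.1 (h hl) with h1 | h1
        · exact h1.le
        · exact h1.1.le
    · exact ((Prod.Lex.toLex_lt_toLex.1 <| h hij).resolve_left he.not_lt).2
  · rintro ⟨h1, h2⟩ i j hij
    apply Prod.Lex.toLex_lt_toLex.2
    rcases (h1 hij.le).eq_or_lt with he | hl
    exacts [Or.inr ⟨he, h2 i j hij he⟩, Or.inl hl]

lemma good_eq_sort {n m : ℕ} (π : Equiv.Perm (Fin n)) (a b : Fin n → Fin m)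
    (hb : ∀ i, b (π i) = a i) : Good π a ↔ π = Tuple.sort b := by
  rw [Tuple.eq_sort_iff, good_iff]
  have : b ∘ π = a := funext hb
  simp only [this, hb]

/-- the pairs function is lex-monotone -/
lemma pair_mono {n m : ℕ} (π : Equiv.Perm (Fin n)) (a : Fin n → Fin m) (h : Good π a) :
    Monotone fun i => toLex (a i, a (π i)) := by
  intro i j hij
  rcases hij.eq_or_lt with rfl | hl
  · exact le_rfl
  rw [good_iff] at h
  apply Prod.Lex.toLex_le_toLex.2
  rcases (h.1 hl.le).eq_or_lt with he | hl'
  · exact Or.inr ⟨he, h.1 (h.2 i j hl he).le⟩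
  · exact Or.inl hl'

open Classical in
noncomputable def XX (n m : ℕ) : Finset (Equiv.Perm (Fin n) × (Fin n → Fin m)) :=
  univ.filter fun p => p.1 * p.1 = 1 ∧ Good p.1 p.2

def Y (n m : ℕ) : Finset (Fin m × Fin m → ℕ) :=
  (piAntidiag univ n).filter fun M => ∀ c d, M (c, d) = M (d, c)

lemma mem_Y {n m : ℕ} {M} : M ∈ Y n m ↔ ∑ p, M p = n ∧ ∀ c d, M (c, d) = M (d, c) := by
  simp [Y]

def Phi {n m : ℕ} (p : Equiv.Perm (Fin n) × (Fin n → Fin m)) : Fin m × Fin m → ℕ :=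
  fun q => (univ.filter fun i => (p.2 i, p.2 (p.1 i)) = q).card

lemma card_swap {n m : ℕ} (π : Equiv.Perm (Fin n)) (u v u' v' : Fin n → Fin m)
    (h : ∀ i, u (π i) = v' i ∧ v (π i) = u' i) (c d : Fin m) :
    (univ.filter fun i => (u' i, v' i) = (c, d)).card =
    (univ.filter fun i => (u i, v i) = (d, c)).card := by
  apply Finset.card_bij (fun i _ => π i)
  · intro i; simp only [mem_filter, mem_univ, true_and, Prod.mk.injEq, (h i).1, (h i).2]; tauto
  · intro i _ j _ hij; exact π.injective hij
  · intro j hj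
    refine ⟨π.symm j, ?_, by simp⟩
    have := h (π.symm j)
    simp only [Equiv.apply_symm_apply] at this
    simp only [mem_filter, mem_univ, true_and, Prod.mk.injEq, ← this.1, ← this.2] at hj ⊢; tauto

lemma card_XX (n m : ℕ) : (XX n m).card = (Y n m).card := by
  apply Finset.card_bij (fun p _ => Phi p)
  · rintro ⟨π, a⟩ hp
    simp only [XX, mem_filter, mem_univ, true_and] at hp
    rw [mem_Y]
    constructor
    · have := Finset.card_eq_sum_card_fiberwise (s := (univ : Finset (Fin n)))
        (t := (univ : Finset (Fin m × Fin m))) (f := fun i => (a i, a (π i))) (by simp)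
      simp only [card_univ, Fintype.card_fin] at this
      exact this.symm
    · intro c d
      have hh : ∀ i, π (π i) = i := fun i => by
        have := congrArg (fun σ => σ i) hp.1
        simpa using this
      exact card_swap π a (a ∘ π) a (a ∘ π) (fun i => ⟨rfl, by simp [hh]⟩) c d
  · rintro ⟨π, a⟩ hp ⟨π', a'⟩ hp' he
    simp only [XX, mem_filter, mem_univ, true_and] at hp hp'
    have hinv : ∀ σ : Equiv.Perm (Fin n), σ * σ = 1 → ∀ i, σ (σ i) = i := fun σ hσ i => by
      have := congrArg (fun σ => σ i) hσ
      simpa using this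
    have key := mono_unique _ _ (pair_mono π a hp.2) (pair_mono π' a' hp'.2) (by
      intro x
      have := congrFun he (ofLex x)
      exact this)
    have ha : a = a' := funext fun i => congrArg (fun z => (ofLex z).1) (congrFun key i)
    have hb : a ∘ π = a' ∘ π' := funext fun i => congrArg (fun z => (ofLex z).2) (congrFun key i)
    have h1 := (good_eq_sort π a (a ∘ π) (by simp [hinv π hp.1])).1 hp.2
    have h2 := (good_eq_sort π' a' (a' ∘ π') (by simp [hinv π' hp'.1])).1 hp'.2
    rw [← hb, ← h1] at h2
    rw [ha, h2]
  · intro M hM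
    rw [mem_Y] at hM
    obtain ⟨f, hf, hfM⟩ := mono_exists (β := Fin m ×ₗ Fin m) (n := n) (fun x => M (ofLex x)) hM.1
    let a : Fin n → Fin m := fun i => (ofLex (f i)).1
    let b : Fin n → Fin m := fun i => (ofLex (f i)).2
    have hfM' : ∀ c d, (univ.filter fun i => (a i, b i) = (c, d)).card = M (c, d) :=
      fun c d => hfM (toLex (c, d))
    have hlex : ∀ i j, i ≤ j → a i < a j ∨ a i = a j ∧ b i ≤ b j := fun i j hij =>
      Prod.Lex.le_iff.1 (hf hij)
    have ham : Monotone a := fun i j hij => by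
      rcases hlex i j hij with h | h
      · exact h.le
      · exact h.1.le
    let π := Tuple.sort b
    have hπ := (Tuple.eq_sort_iff (σ := π) (f := b)).1 rfl
    have hlm : Monotone fun i => toLex (b (π i), a (π i)) := by
      intro i j hij
      rcases hij.eq_or_lt with rfl | hl
      · exact le_rfl
      apply Prod.Lex.toLex_le_toLex.2
      rcases (hπ.1 hl.le).eq_or_lt with he | hl'
      · exact Or.inr ⟨he, ham (hπ.2 i j hl he).le⟩
      · exact Or.inl hl'
    have hfe := mono_unique _ f hlm hf (by
      intro x
      rw [hfM]
      have := card_swap π a b (b ∘ π) (a ∘ π) (fun i => ⟨rfl, rfl⟩) (ofLex x).1 (ofLex x).2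
      rw [hfM', ← hM.2] at this
      exact this)
    have h1 : ∀ i, b (π i) = a i := fun i => congrArg (fun z => (ofLex z).1) (congrFun hfe i)
    have h2 : ∀ i, a (π i) = b i := fun i => congrArg (fun z => (ofLex z).2) (congrFun hfe i)
    have hg : Good π a := (good_eq_sort π a b h1).2 rfl
    have hinv : π⁻¹ = π := by
      apply (good_eq_sort π⁻¹ a b (fun i => by rw [← h2]; simp)).1
      rw [good_iff] at hg ⊢
      refine ⟨ham, fun i j hij he => ?_⟩
      by_contra hcon
      push Not at hcon
      have hne : π⁻¹ j < π⁻¹ i := lt_of_le_of_ne hcon (fun h => hij.ne' (π⁻¹.injective h))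
      have e1 : a (π⁻¹ i) = b i := by rw [← h1]; simp
      have e2 : a (π⁻¹ j) = b j := by rw [← h1]; simp
      have e3 := ham hne.le
      have e4 : b i ≤ b j := by
        rcases hlex i j hij.le with h | h
        · exact absurd he h.ne
        · exact h.2
      have := hg.2 _ _ hne (le_antisymm e3 (by rw [e1, e2]; exact e4))
      simp at this
      exact absurd this hij.not_gt
    refine ⟨(π, a), ?_, ?_⟩
    · simp only [XX, mem_filter, mem_univ, true_and]
      refine ⟨?_, hg⟩
      nth_rewrite 1 [← hinv]; simp
    · funext ⟨c, d⟩
      simp only [Phi, h2]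
      exact hfM' c d

lemma Y_add {n m : ℕ} (S : Fin m × Fin m → ℕ) (hS : ∀ c d, S (c, d) = S (d, c)) (s : ℕ)
    (hs : ∑ p, S p = s) (q : Fin m × Fin m) (hq : S q = 1)
    (hle : ∀ M : Fin m × Fin m → ℕ, (∀ c d, M (c, d) = M (d, c)) → 1 ≤ M q → S ≤ M) :
    ∑ M ∈ Y (n + s) m, M q = ∑ M ∈ Y n m, M q + (Y n m).card := by
  rw [Finset.card_eq_sum_ones, ← Finset.sum_add_distrib]
  symm
  rw [← Finset.sum_filter_ne_zero (s := Y (n + s) m)]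
  apply Finset.sum_bij (fun M _ => M + S)
  · intro M hM
    rw [mem_Y] at hM
    rw [mem_filter, mem_Y]
    refine ⟨⟨?_, ?_⟩, ?_⟩
    · simp [Finset.sum_add_distrib, hM.1, hs]
    · intro c d; simp [hM.2 c d, hS c d]
    · simp [hq]
  · intro M _ M' _ h; exact add_right_cancel h
  · intro M hM
    rw [mem_filter, mem_Y] at hM
    have h := hle M hM.1.2 (Nat.one_le_iff_ne_zero.2 hM.2)
    refine ⟨M - S, ?_, tsub_add_cancel_of_le h⟩
    rw [mem_Y]
    constructor
    · have h1 : ∑ p, (M - S) p + ∑ p, S p = ∑ p, M p := by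
        rw [← Finset.sum_add_distrib]
        exact Finset.sum_congr rfl fun p _ => Nat.sub_add_cancel (h p)
      omega
    · intro c d; simp [hM.1.2 c d, hS c d]
  · intro M _; simp [hq]

lemma Y_diag (n m : ℕ) (c : Fin m) :
    ∑ M ∈ Y (n + 1) m, M (c, c) = ∑ M ∈ Y n m, M (c, c) + (Y n m).card := by
  apply Y_add (Pi.single (c, c) 1)
  · intro a b; simp only [Pi.single_apply, Prod.mk.injEq]; congr 1; simp only [and_comm]
  · simp
  · simp
  · intro M _ h q
    by_cases hq : q = (c, c)
    · subst hq; simpa using h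
    · simp [hq]

lemma Y_off (n m : ℕ) (c d : Fin m) (hcd : c ≠ d) :
    ∑ M ∈ Y (n + 2) m, M (c, d) = ∑ M ∈ Y n m, M (c, d) + (Y n m).card := by
  apply Y_add (Pi.single (c, d) 1 + Pi.single (d, c) 1)
  · intro a b
    simp only [Pi.add_apply, Pi.single_apply, Prod.mk.injEq]
    rw [add_comm]
    congr 2 <;> simp only [and_comm]
  · simp [Finset.sum_add_distrib]
  · simp [hcd]
  · intro M hM h q
    by_cases hq : q = (c, d)
    · subst hq; simpa [hcd] using h
    · by_cases hq' : q = (d, c)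
      · subst hq'; rw [hM] at h; simpa [hq] using h
      · simp [hq, hq']

lemma Y_rec (n m : ℕ) :
    (n + 2) * (Y (n + 2) m).card = m * (Y (n + 1) m).card + (m ^ 2 + n) * (Y n m).card := by
  have tot : ∀ n, n * (Y n m).card = ∑ q : Fin m × Fin m, ∑ M ∈ Y n m, M q := by
    intro n
    rw [Finset.sum_comm, Finset.sum_congr rfl (fun M hM => (mem_Y.1 hM).1)]
    simp [mul_comm]
  have step : ∀ q : Fin m × Fin m, ∑ M ∈ Y (n + 2) m, M q = ∑ M ∈ Y n m, M q + (Y n m).card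
      + if q.1 = q.2 then (Y (n + 1) m).card else 0 := by
    rintro ⟨c, d⟩
    by_cases h : c = d
    · subst h
      simp only [if_true]
      rw [Y_diag, Y_diag]
    · simp only [h, if_false]; rw [Y_off _ _ _ _ h]; rfl
  rw [tot (n + 2), Finset.sum_congr rfl (fun q _ => step q), Finset.sum_add_distrib,
    Finset.sum_add_distrib, ← tot n, Fintype.sum_prod_type, Fintype.sum_prod_type]
  simp
  ring

/-- weakly increasing sequences with prescribed minimal steps -/
def A (δ : ℕ → ℕ) (n m : ℕ) : Finset (Fin n → ℕ) :=
  (Fintype.piFinset fun _ : Fin n => range m).filter fun a =>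
    ∀ i j : Fin n, (j : ℕ) = i + 1 → a i + δ j ≤ a j

lemma mem_A {δ : ℕ → ℕ} {n m : ℕ} {a : Fin n → ℕ} :
    a ∈ A δ n m ↔ (∀ i, a i < m) ∧ ∀ i j : Fin n, (j : ℕ) = i + 1 → a i + δ j ≤ a j := by
  simp [A]

lemma A_mono {δ : ℕ → ℕ} {n : ℕ} {a : Fin n → ℕ}
    (h : ∀ i j : Fin n, (j : ℕ) = i + 1 → a i + δ j ≤ a j) : Monotone a := by
  cases n with
  | zero => intro i; exact i.elim0
  | succ n =>
    rw [Fin.monotone_iff_le_succ]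
    intro i
    have := h i.castSucc i.succ (by simp)
    omega

lemma A_last {δ : ℕ → ℕ} {n m : ℕ} :
    ((A δ (n + 1) (m + 1)).filter fun a => a (Fin.last n) = m).card = (A δ n (m + 1 - δ n)).card := by
  apply Finset.card_bij' (fun a _ => fun i : Fin n => a i.castSucc)
    (fun a _ => (Fin.snoc a m : Fin (n + 1) → ℕ))
  · intro a ha
    rw [mem_filter, mem_A] at ha
    obtain ⟨⟨h1, h2⟩, h3⟩ := ha
    rw [mem_A]
    have hm := A_mono h2
    refine ⟨fun i => ?_, fun i j hij => h2 i.castSucc j.castSucc (by simpa using hij)⟩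
    have hi := i.isLt
    have e1 := h2 (⟨n - 1, by omega⟩) (Fin.last n) (by simp; omega)
    have e2 : a i.castSucc ≤ a ⟨n - 1, by omega⟩ := hm (by
      rw [Fin.le_def]; simp; omega)
    simp only [Fin.val_last] at e1
    omega
  · intro a ha
    rw [mem_A] at ha
    obtain ⟨h1, h2⟩ := ha
    rw [mem_filter, mem_A]
    refine ⟨⟨fun i => ?_, fun i j hij => ?_⟩, by simp⟩
    · refine Fin.lastCases (by simp) (fun i => ?_) i
      have := h1 i
      simp; omega
    · induction j using Fin.lastCases with
      | last =>
        induction i using Fin.lastCases with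
        | last => simp at hij
        | cast i => 
          have := h1 i
          simp; omega
      | cast j =>
        induction i using Fin.lastCases with
        | last => have := j.isLt; simp at hij; omega
        | cast i => simpa using h2 i j (by simpa using hij)
  · intro a ha
    rw [mem_filter] at ha
    rw [← ha.2]
    exact Fin.snoc_init_self a
  · intro a ha
    funext i; simp

lemma A_succ {δ : ℕ → ℕ} {n m : ℕ} :
    (A δ (n + 1) (m + 1)).card = (A δ (n + 1) m).card + (A δ n (m + 1 - δ n)).card := by
  rw [← A_last, ← Finset.card_filter_add_card_filter_not (fun a => a (Fin.last n) = m), add_comm]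
  congr 2
  ext a
  rw [mem_filter, mem_A, mem_A]
  constructor
  · rintro ⟨⟨h1, h2⟩, h3⟩
    refine ⟨fun i => ?_, h2⟩
    have := A_mono h2 (Fin.le_last i)
    have := h1 (Fin.last n)
    omega
  · rintro ⟨h1, h2⟩
    exact ⟨⟨fun i => (h1 i).trans (Nat.lt_succ_self m), h2⟩, (h1 _).ne⟩

lemma A_card {δ : ℕ → ℕ} (hδ : δ 0 = 0) (n m : ℕ) :
    (A δ n m).card = (n + m - (∑ i ∈ range n, δ i + 1)).choose n := by
  induction n generalizing m with
  | zero =>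
    simp only [Nat.choose_zero_right, Finset.card_eq_one]
    refine ⟨Fin.elim0, ?_⟩
    ext a
    rw [mem_A, mem_singleton]
    exact ⟨fun _ => Subsingleton.elim _ _, fun _ => ⟨fun i => i.elim0, fun i => i.elim0⟩⟩
  | succ n ih =>
    induction m with
    | zero =>
      rw [Nat.choose_eq_zero_of_lt (by omega), Finset.card_eq_zero, Finset.eq_empty_iff_forall_notMem]
      intro a ha
      rw [mem_A] at ha
      exact absurd (ha.1 0) (by omega)
    | succ m ihm =>
      rw [A_succ, ihm, ih, Finset.sum_range_succ]
      set k := ∑ i ∈ range n, δ i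
      by_cases h : k + δ n ≤ m
      · have e1 : n + 1 + (m + 1) - (k + δ n + 1) = (n + (m - (k + δ n))) + 1 := by omega
        have e2 : n + 1 + m - (k + δ n + 1) = n + (m - (k + δ n)) := by omega
        have e3 : n + (m + 1 - δ n) - (k + 1) = n + (m - (k + δ n)) := by omega
        rw [e1, e2, e3, Nat.choose_succ_succ, add_comm]
      · have hn : n ≠ 0 := by
          rintro rfl
          simp [k, hδ] at h
        rw [Nat.choose_eq_zero_of_lt (by omega), Nat.choose_eq_zero_of_lt (by omega),
          Nat.choose_eq_zero_of_lt (by omega)]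

open Classical in
lemma good_card {n m : ℕ} (π : Equiv.Perm (Fin n)) :
    (univ.filter fun a : Fin n → Fin m => Good π a).card = (n + m - (desNum π + 1)).choose n := by
  let D : ℕ → Prop := fun j => ∃ i j' : Fin n, (j' : ℕ) = j ∧ (j' : ℕ) = i + 1 ∧ π j' < π i
  let δ : ℕ → ℕ := fun j => if D j then 1 else 0
  have hδ : δ 0 = 0 := by
    simp only [δ, D]
    rw [if_neg]
    rintro ⟨i, j, h1, h2, _⟩
    omega
  have hk : desNum π = ∑ i ∈ range n, δ i := by
    simp only [δ]
    rw [Finset.sum_boole, Nat.cast_id, desNum]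
    apply Finset.card_bij (fun (i : Fin n) _ => (i : ℕ) + 1)
    · intro i hi
      simp only [mem_filter, mem_univ, true_and] at hi
      obtain ⟨j, h1, h2⟩ := hi
      rw [mem_filter, mem_range]
      exact ⟨h1 ▸ j.isLt, i, j, h1, h1, h2⟩
    · intro i _ j _ h; exact Fin.ext (by omega)
    · intro j hj
      rw [mem_filter] at hj
      obtain ⟨_, i, j', h1, h2, h3⟩ := hj
      refine ⟨i, ?_, by omega⟩
      simp only [mem_filter, mem_univ, true_and]
      exact ⟨j', h2, h3⟩
  rw [hk, ← A_card hδ]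
  have hgood : ∀ a : Fin n → Fin m, Good π a ↔
      ∀ i j : Fin n, (j : ℕ) = i + 1 → (a i : ℕ) + δ j ≤ a j := by
    intro a
    have hstep : ∀ i j : Fin n, (j : ℕ) = i + 1 →
        (toLex (a i, π i) < toLex (a j, π j) ↔ (a i : ℕ) + δ j ≤ a j) := by
      intro i j hij
      have hD : D j ↔ π j < π i := by
        constructor
        · rintro ⟨i', j', h1, h2, h3⟩
          obtain rfl : j' = j := Fin.ext h1
          obtain rfl : i' = i := Fin.ext (by omega)
          exact h3
        · intro h; exact ⟨i, j, rfl, hij, h⟩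
      have hne : π i ≠ π j := fun h => by
        have := congrArg Fin.val (π.injective h); omega
      rw [Prod.Lex.toLex_lt_toLex]
      simp only [δ]
      by_cases h : π j < π i
      · rw [if_pos (hD.2 h)]
        have : ¬ π i < π j := h.not_gt
        simp only [this, and_false, or_false, Fin.lt_def]
        omega
      · rw [if_neg (fun h' => h (hD.1 h'))]
        have : π i < π j := lt_of_le_of_ne (not_lt.1 h) hne
        simp only [this, and_true, Fin.lt_def, Fin.ext_iff]
        omega
    constructor
    · intro h i j hij
      exact (hstep i j hij).1 (h (Fin.lt_def.2 (by omega)))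
    · intro h
      unfold Good
      cases n with
      | zero => intro i; exact i.elim0
      | succ n =>
        rw [Fin.strictMono_iff_lt_succ]
        intro i
        exact (hstep _ _ (by simp)).2 (h _ _ (by simp))
  apply Finset.card_bij (fun a _ => fun i => (a i : ℕ))
  · intro a ha
    simp only [mem_filter, mem_univ, true_and] at ha
    rw [mem_A]
    exact ⟨fun i => (a i).isLt, (hgood a).1 ha⟩
  · intro a _ b _ h
    funext i; exact Fin.ext (congrFun h i)
  · intro a ha
    rw [mem_A] at ha
    refine ⟨fun i => ⟨a i, ha.1 i⟩, ?_, rfl⟩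
    simp only [mem_filter, mem_univ, true_and]
    exact (hgood _).2 ha.2

/-- basis functions -/
def bb (n r k : ℕ) : ℤ := if k ≤ r then ((n + (r - k)).choose n : ℤ) else 0

lemma Y_card (n r : ℕ) (hn : 0 < n) :
    ((Y n (r + 1)).card : ℤ) = ∑ k ∈ range (r + 1), (invCount n k : ℤ) * bb n r k := by
  classical
  rw [← card_XX]
  have h1 : (XX n (r + 1)).card = ∑ π ∈ univ.filter (fun π : Equiv.Perm (Fin n) => π * π = 1),
      (n + (r + 1) - (desNum π + 1)).choose n := by
    simp only [← good_card]
    rw [← Finset.card_sigma]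
    apply Finset.card_bij (fun p _ => ⟨p.1, p.2⟩)
    · intro p hp; simpa [XX] using hp
    · intro p _ q _ h; simp at h; exact Prod.ext h.1 h.2
    · rintro ⟨π, a⟩ h
      exact ⟨(π, a), by simpa [XX] using h, rfl⟩
  have h2 : ∀ π : Equiv.Perm (Fin n), (((n + (r + 1) - (desNum π + 1)).choose n : ℕ) : ℤ)
      = bb n r (desNum π) := by
    intro π
    unfold bb
    split_ifs with h
    · congr 2; omega
    · rw [Nat.choose_eq_zero_of_lt (by omega)]; rfl
  rw [h1]
  push_cast
  simp only [h2, invCount]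
  have h3 : ∀ k, ((univ.filter fun π : Equiv.Perm (Fin n) => π * π = 1 ∧ desNum π = k).card : ℤ)
      * bb n r k = ∑ π ∈ univ.filter (fun π : Equiv.Perm (Fin n) => π * π = 1),
        if desNum π = k then bb n r k else 0 := by
    intro k
    rw [← Finset.sum_filter, Finset.filter_filter, Finset.sum_const, nsmul_eq_mul]
  simp only [h3]
  rw [Finset.sum_comm]
  apply Finset.sum_congr rfl
  intro π _
  rw [Finset.sum_ite_eq]
  split_ifs with h
  · rfl
  · rw [mem_range] at h
    rw [bb, if_neg (by omega)]

lemma ch1 (n x : ℕ) :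
    ((n + 1 : ℕ) : ℤ) * ((n + 1 + x).choose (n + 1) : ℤ) = (n + 1 + x) * ((n + x).choose n : ℤ) := by
  have := Nat.add_one_mul_choose_eq (n + x) n
  rw [show n + x + 1 = n + 1 + x by omega] at this
  have h : ((n + 1 + x : ℕ) : ℤ) * ((n + x).choose n : ℕ) =
    ((n + 1 + x).choose (n + 1) : ℕ) * ((n + 1 : ℕ) : ℤ) := by exact_mod_cast this
  push_cast at h ⊢; linarith

lemma ch2 (n x : ℕ) :
    ((n + 1 : ℕ) : ℤ) * ((n + x).choose (n + 1) : ℤ) = x * ((n + x).choose n : ℤ) := by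
  have := Nat.choose_succ_right_eq (n + x) n
  rw [Nat.add_sub_cancel_left] at this
  have h : (((n + x).choose (n + 1) : ℕ) : ℤ) * ((n + 1 : ℕ) : ℤ)
    = ((n + x).choose n : ℕ) * (x : ℤ) := by exact_mod_cast this
  push_cast at h ⊢; linarith

lemma bb_a (n r k : ℕ) : ((n : ℤ) + 1) * bb (n + 1) r k = (n + 1 + (r - k)) * bb n r k := by
  unfold bb
  split_ifs with h
  · have := ch1 n (r - k)
    push_cast [Nat.cast_sub h] at this ⊢; linarith
  · simp

lemma bb_b (n r k : ℕ) : ((n : ℤ) + 1) * bb (n + 1) r (k + 1) = (r - k) * bb n r k := by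
  unfold bb
  by_cases h : k + 1 ≤ r
  · rw [if_pos h, if_pos (by omega)]
    have := ch2 n (r - k)
    rw [show n + 1 + (r - (k + 1)) = n + (r - k) by omega]
    push_cast [Nat.cast_sub (show k ≤ r by omega)] at this ⊢; linarith
  · rw [if_neg h]
    split_ifs with h'
    · have : r = k := by omega
      subst this; simp
    · simp

lemma id1 (n r k : ℕ) : ((r : ℤ) + 1) * bb n r k =
    (k + 1) * bb (n + 1) r k + (n - k) * bb (n + 1) r (k + 1) := by
  have h1 := bb_a n r k
  have h2 := bb_b n r k
  have : ((n : ℤ) + 1) ≠ 0 := by positivity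
  apply mul_left_cancel₀ this
  linear_combination (-(k + 1 : ℤ)) * h1 - (n - k : ℤ) * h2

lemma id2 (n r k : ℕ) : (((r : ℤ) + 1) ^ 2 + n) * bb n r k =
    ((k + 1) ^ 2 + n) * bb (n + 2) r k
    + (2 * (k + 1) * (n - k) - n + 1) * bb (n + 2) r (k + 1)
    + ((n - k) ^ 2 + n) * bb (n + 2) r (k + 2) := by
  have h1 := bb_a n r k
  have h2 := bb_b n r k
  have h3 := bb_a (n + 1) r k
  have h4 := bb_b (n + 1) r k
  have h5 := bb_b (n + 1) r (k + 1)
  push_cast at h3 h4 h5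
  have e : ((n : ℤ) + 1) * (n + 2) ≠ 0 := by positivity
  apply mul_left_cancel₀ e
  have g3 : ((n : ℤ) + 1) * (n + 2) * bb (n + 2) r k
      = (n + 2 + (r - k)) * (n + 1 + (r - k)) * bb n r k := by
    linear_combination (n + 1 : ℤ) * h3 + (n + 2 + (r - k) : ℤ) * h1
  have g4 : ((n : ℤ) + 1) * (n + 2) * bb (n + 2) r (k + 1)
      = (r - k) * (n + 1 + (r - k)) * bb n r k := by
    linear_combination (n + 1 : ℤ) * h4 + (r - k : ℤ) * h1
  have g5 : ((n : ℤ) + 1) * (n + 2) * bb (n + 2) r (k + 2)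
      = (r - k) * (r - k - 1) * bb n r k := by
    linear_combination (n + 1 : ℤ) * h5 + (r - k - 1 : ℤ) * h2
  linear_combination (-((k + 1) ^ 2 + n : ℤ)) * g3
    - (2 * (k + 1) * (n - k) - n + 1 : ℤ) * g4 - ((n - k) ^ 2 + n : ℤ) * g5

lemma shift (r : ℕ) (f b : ℕ → ℤ) (f' : ℕ → ℤ) (h0 : f' 0 = 0) (hs : ∀ k, f' (k + 1) = f k)
    (hb : b (r + 1) = 0) :
    ∑ k ∈ range (r + 1), f k * b (k + 1) = ∑ k ∈ range (r + 1), f' k * b k := by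
  rw [Finset.sum_range_succ, Finset.sum_range_succ', hb, h0]
  simp [hs]

lemma Iz_nat (n k : ℕ) : Iz n k = invCount n k := by simp [Iz]

lemma Iz_neg (n : ℕ) (k : ℤ) (h : k < 0) : Iz n k = 0 := by simp [Iz, not_le.2 h]

/-- the right-hand side of the recurrence -/
def G (n k : ℕ) : ℤ :=
  ((k : ℤ) + 1) * Iz (n + 1) k
  + ((n : ℤ) + 2 - k) * Iz (n + 1) ((k : ℤ) - 1)
  + (((k : ℤ) + 1) ^ 2 + n) * Iz n k
  + (2 * (k : ℤ) * ((n : ℤ) + 1 - k) - n + 1) * Iz n ((k : ℤ) - 1)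
  + (((n : ℤ) + 2 - k) ^ 2 + n) * Iz n ((k : ℤ) - 2)

lemma sum_G (n r : ℕ) (hn : 0 < n) :
    ∑ k ∈ range (r + 1), G n k * bb (n + 2) r k =
      ∑ k ∈ range (r + 1), ((n : ℤ) + 2) * Iz (n + 2) k * bb (n + 2) r k := by
  have hY := Y_rec n (r + 1)
  have hY' : ((n : ℤ) + 2) * ((Y (n + 2) (r + 1)).card : ℤ) = (r + 1) * ((Y (n + 1) (r + 1)).card : ℤ)
    + ((r + 1) ^ 2 + n) * ((Y n (r + 1)).card : ℤ) := by exact_mod_cast hY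
  rw [Y_card _ _ (by omega), Y_card _ _ (by omega), Y_card _ _ hn, Finset.mul_sum, Finset.mul_sum,
    Finset.mul_sum] at hY'
  have hl : ∑ k ∈ range (r + 1), ((n : ℤ) + 2) * Iz (n + 2) k * bb (n + 2) r k =
      ∑ k ∈ range (r + 1), ((n : ℤ) + 2) * ((invCount (n + 2) k : ℤ) * bb (n + 2) r k) :=
    Finset.sum_congr rfl fun k _ => by rw [Iz_nat]; ring
  rw [hl, hY']
  have z1 : bb (n + 2) r (r + 1) = 0 := by simp [bb]
  have z2 : bb (n + 2) r (r + 2) = 0 := by simp [bb]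
  have t1 : ∑ k ∈ range (r + 1), ((r : ℤ) + 1) * ((invCount (n + 1) k : ℤ) * bb (n + 1) r k) =
      ∑ k ∈ range (r + 1), ((k : ℤ) + 1) * Iz (n + 1) k * bb (n + 2) r k +
      ∑ k ∈ range (r + 1), ((n : ℤ) + 2 - k) * Iz (n + 1) ((k : ℤ) - 1) * bb (n + 2) r k := by
    rw [← shift r (fun k => ((n : ℤ) + 1 - k) * Iz (n + 1) k) (bb (n + 2) r)
      (fun k => ((n : ℤ) + 2 - k) * Iz (n + 1) ((k : ℤ) - 1)) (by simp [Iz_neg])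
      (fun k => by push_cast; rw [add_sub_cancel_right]; ring) z1, ← Finset.sum_add_distrib]
    refine Finset.sum_congr rfl fun k _ => ?_
    have := id1 (n + 1) r k
    rw [Iz_nat]
    push_cast at this
    linear_combination (invCount (n + 1) k : ℤ) * this
  have t2 : ∑ k ∈ range (r + 1), (((r : ℤ) + 1) ^ 2 + n) * ((invCount n k : ℤ) * bb n r k) =
      ∑ k ∈ range (r + 1), (((k : ℤ) + 1) ^ 2 + n) * Iz n k * bb (n + 2) r k +
      ∑ k ∈ range (r + 1), (2 * (k : ℤ) * ((n : ℤ) + 1 - k) - n + 1) * Iz n ((k : ℤ) - 1)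
        * bb (n + 2) r k +
      ∑ k ∈ range (r + 1), (((n : ℤ) + 2 - k) ^ 2 + n) * Iz n ((k : ℤ) - 2) * bb (n + 2) r k := by
    rw [← shift r (fun k => (2 * ((k : ℤ) + 1) * ((n : ℤ) - k) - n + 1) * Iz n k) (bb (n + 2) r)
      (fun k => (2 * (k : ℤ) * ((n : ℤ) + 1 - k) - n + 1) * Iz n ((k : ℤ) - 1)) (by simp [Iz_neg])
      (fun k => by push_cast; rw [add_sub_cancel_right]; ring) z1,
      ← shift r (fun k => (((n : ℤ) + 1 - k) ^ 2 + n) * Iz n ((k : ℤ) - 1)) (bb (n + 2) r)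
      (fun k => (((n : ℤ) + 2 - k) ^ 2 + n) * Iz n ((k : ℤ) - 2)) (by simp [Iz_neg])
      (fun k => by
        push_cast
        rw [show (k : ℤ) + 1 - 2 = k - 1 by ring]; ring) z1,
      ← shift r (fun k => (((n : ℤ) - k) ^ 2 + n) * Iz n k) (fun k => bb (n + 2) r (k + 1))
      (fun k => (((n : ℤ) + 1 - k) ^ 2 + n) * Iz n ((k : ℤ) - 1)) (by simp [Iz_neg])
      (fun k => by push_cast; rw [add_sub_cancel_right]; ring) z2,
      ← Finset.sum_add_distrib, ← Finset.sum_add_distrib]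
    refine Finset.sum_congr rfl fun k _ => ?_
    have := id2 n r k
    rw [Iz_nat]
    linear_combination (invCount n k : ℤ) * this
  rw [t1, t2, ← Finset.sum_add_distrib, ← Finset.sum_add_distrib, ← Finset.sum_add_distrib,
    ← Finset.sum_add_distrib]
  refine Finset.sum_congr rfl fun k _ => ?_
  unfold G; ring

lemma main (n : ℕ) (hn : 0 < n) (k : ℕ) : G n k = ((n : ℤ) + 2) * Iz (n + 2) k := by
  induction k using Nat.strong_induction_on with
  | _ k ih =>
    have h := sum_G n k hn
    rw [Finset.sum_range_succ, Finset.sum_range_succ,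
      Finset.sum_congr rfl (fun j hj => by rw [ih j (mem_range.1 hj)])] at h
    have hb : bb (n + 2) k k = 1 := by simp [bb]
    rw [hb] at h
    linarith

end IR

/-- Recurrence for the numbers `I_{n,k}`. -/
theorem I_recurrence (n : ℕ) (hn : 3 ≤ n) (k : ℕ) :
    (n : ℤ) * Iz n k
      = ((k : ℤ) + 1) * Iz (n - 1) k
        + ((n : ℤ) - k) * Iz (n - 1) ((k : ℤ) - 1)
        + (((k : ℤ) + 1) ^ 2 + n - 2) * Iz (n - 2) k
        + (2 * (k : ℤ) * ((n : ℤ) - k - 1) - n + 3) * Iz (n - 2) ((k : ℤ) - 1)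
        + (((n : ℤ) - k) ^ 2 + n - 2) * Iz (n - 2) ((k : ℤ) - 2) := by
  obtain ⟨p, rfl⟩ : ∃ p, n = p + 2 := ⟨n - 2, by omega⟩
  have h := IR.main p (by omega) k
  unfold IR.G at h
  rw [show p + 2 - 1 = p + 1 by omega, show p + 2 - 2 = p by omega]
  push_cast
  linear_combination -h
end

section
/- For all n ≥ 1 and all 0 ≤ k ≤ n-1, I_{n,k} = I_{n,n-1-k}; that is, the distribution of the descent number over involutions of {1,...,n} is symmetric. -/
open Finset Polynomial

namespace InvSymm

variable {n : ℕ}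

/-- `ρ` preserves the fibres of `f` and reverses the order on each. -/
def IsRev {β : Type*} (f : Fin n → β) (ρ : Equiv.Perm (Fin n)) : Prop :=
  (∀ a, f (ρ a) = f a) ∧ ∀ a b, a < b → f a = f b → ρ b < ρ a

lemma eq_one_of_mono {β : Type*} (f : Fin n → β) (τ : Equiv.Perm (Fin n))
    (h1 : ∀ a, f (τ a) = f a) (h2 : ∀ a b, a < b → f a = f b → τ a < τ b) : τ = 1 := by
  have key : ∀ m : ℕ, ∀ a : Fin n, a.val = m → τ a = a := by
    intro m
    induction m using Nat.strong_induction_on with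
    | _ m ih =>
      intro a ha
      by_contra hne
      have hlt : a < τ a := by
        rcases lt_or_gt_of_ne hne with h | h
        · have := ih (τ a).val (by rw [← ha]; exact h) (τ a) rfl
          exact absurd (τ.injective this) hne
        · exact h
      obtain ⟨b, hb⟩ := τ.surjective a
      have hab : a < b := by
        rcases lt_trichotomy a b with h | h | h
        · exact h
        · subst h; exact absurd hb hne
        · have := ih b.val (by rw [← ha]; exact h) b rfl
          rw [this] at hb
          exact absurd hb h.ne
      have := h2 a b hab (by rw [← hb, h1])
      rw [hb] at this
      exact absurd this (not_lt.mpr hlt.le)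
  ext a
  simp [key a.val a rfl]

lemma IsRev.inv {β : Type*} {f : Fin n → β} {ρ : Equiv.Perm (Fin n)} (h : IsRev f ρ) :
    IsRev f ρ⁻¹ := by
  have h1 : ∀ a, f (ρ⁻¹ a) = f a := fun a => by
    rw [← h.1 (ρ⁻¹ a)]; simp
  refine ⟨h1, fun a b hab hf => ?_⟩
  rcases lt_trichotomy (ρ⁻¹ a) (ρ⁻¹ b) with h' | h' | h'
  · have := h.2 _ _ h' (by rw [h1, h1, hf])
    simp at this
    exact absurd this (not_lt.mpr hab.le)
  · exact absurd (ρ⁻¹.injective h') hab.ne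
  · exact h'

lemma IsRev.unique {β : Type*} {f : Fin n → β} {ρ σ : Equiv.Perm (Fin n)} (h : IsRev f ρ)
    (h' : IsRev f σ) : ρ = σ := by
  have : ρ⁻¹ * σ = 1 := by
    refine eq_one_of_mono f _ (fun a => ?_) (fun a b hab hf => ?_)
    · simp only [Equiv.Perm.mul_apply]; rw [h.inv.1, h'.1]
    · exact h.inv.2 _ _ (h'.2 a b hab hf) (by rw [h'.1, h'.1, hf])
  exact inv_mul_eq_one.mp this

lemma exists_rev {β : Type*} (f : Fin n → β) : ∃ ρ, IsRev f ρ := by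
  classical
  let o : ∀ c, Fin (Fintype.card {a // f a = c}) ≃o {a // f a = c} :=
    fun c => Fintype.orderIsoFinOfCardEq _ rfl
  let e : ∀ c, {a // f a = c} ≃ {a // f a = c} :=
    fun c => ((o c).symm.toEquiv.trans Fin.revPerm).trans (o c).toEquiv
  have he : ∀ c (x y : {a // f a = c}), x < y → e c y < e c x := by
    intro c x y hxy
    simp only [e, Equiv.trans_apply]
    simpa using hxy
  refine ⟨Equiv.ofFiberEquiv e, fun a => Equiv.ofFiberEquiv_map e a, fun a b hab hf => ?_⟩
  have hv : ∀ c (x : {a // f a = c}), Equiv.ofFiberEquiv e x.1 = (e c x).1 := by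
    rintro c ⟨x, rfl⟩
    rfl
  have := he (f b) ⟨a, hf⟩ ⟨b, rfl⟩ hab
  rw [hv (f b) ⟨a, hf⟩, hv (f b) ⟨b, rfl⟩]
  exact this

noncomputable def rev {β : Type*} (f : Fin n → β) : Equiv.Perm (Fin n) := (exists_rev f).choose

lemma rev_spec {β : Type*} (f : Fin n → β) : IsRev f (rev f) := (exists_rev f).choose_spec

lemma rev_mul_rev {β : Type*} (f : Fin n → β) : rev f * rev f = 1 := by
  have := (rev_spec f).inv.unique (rev_spec f)
  nth_rewrite 1 [← this]
  simp

/-- block pairs -/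
def pr (b : Fin n → ℕ) (π : Equiv.Perm (Fin n)) (a : Fin n) : ℕ × ℕ := (b a, b (π a))

noncomputable def T (b : Fin n → ℕ) (π : Equiv.Perm (Fin n)) : Equiv.Perm (Fin n) :=
  π * rev (pr b π)

lemma pr_T (b : Fin n → ℕ) (π : Equiv.Perm (Fin n)) : pr b (T b π) = pr b π := by
  funext a
  have h := (rev_spec (pr b π)).1 a
  simp only [pr, Prod.mk.injEq] at h
  simp only [pr, T, Equiv.Perm.mul_apply, Prod.mk.injEq, true_and]
  exact h.2

lemma T_T (b : Fin n → ℕ) (π : Equiv.Perm (Fin n)) : T b (T b π) = π := by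
  rw [T, pr_T, T, mul_assoc, rev_mul_rev, mul_one]

def Mono (b : Fin n → ℕ) (π : Equiv.Perm (Fin n)) : Prop :=
  ∀ x y, x < y → pr b π x = pr b π y → π x < π y

def Anti (b : Fin n → ℕ) (π : Equiv.Perm (Fin n)) : Prop :=
  ∀ x y, x < y → pr b π x = pr b π y → π y < π x

lemma pr_swap (b : Fin n → ℕ) (π : Equiv.Perm (Fin n)) (h : π * π = 1) (a : Fin n) :
    pr b π (π a) = (pr b π a).swap := by
  have : π (π a) = a := by rw [← Equiv.Perm.mul_apply, h]; rfl
  simp [pr, this]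

lemma T_invol (b : Fin n → ℕ) (π : Equiv.Perm (Fin n)) (h : π * π = 1)
    (hm : Mono b π ∨ Anti b π) : T b π * T b π = 1 := by
  have hpi : ∀ a, π (π a) = a := fun a => by rw [← Equiv.Perm.mul_apply, h]; rfl
  have r := rev_spec (pr b π)
  have key : π * rev (pr b π) * π = rev (pr b π) := by
    refine IsRev.unique (f := pr b π) ⟨fun a => ?_, fun x y hxy hf => ?_⟩ r
    · simp only [Equiv.Perm.mul_apply]
      rw [pr_swap b π h, r.1, pr_swap b π h, Prod.swap_swap]
    · simp only [Equiv.Perm.mul_apply]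
      have e : pr b π (π x) = pr b π (π y) := by rw [pr_swap b π h, pr_swap b π h, hf]
      rcases hm with hm | hm
      · exact hm _ _ (r.2 _ _ (hm x y hxy hf) e) (by rw [r.1, r.1, e])
      · exact hm _ _ (r.2 _ _ (hm x y hxy hf) e.symm) (by rw [r.1, r.1, e])
  calc T b π * T b π = (π * rev (pr b π) * π) * rev (pr b π) := by simp only [T, mul_assoc]
    _ = 1 := by rw [key, rev_mul_rev]

lemma T_anti (b : Fin n → ℕ) (π : Equiv.Perm (Fin n)) (hm : Mono b π) : Anti b (T b π) := by
  intro x y hxy hf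
  rw [pr_T] at hf
  have r := rev_spec (pr b π)
  exact hm _ _ (r.2 x y hxy hf) (by rw [r.1, r.1, hf])

lemma T_mono (b : Fin n → ℕ) (π : Equiv.Perm (Fin n)) (hm : Anti b π) : Mono b (T b π) := by
  intro x y hxy hf
  rw [pr_T] at hf
  have r := rev_spec (pr b π)
  exact hm _ _ (r.2 x y hxy hf) (by rw [r.1, r.1, hf])

def Inc (b : Fin n → ℕ) (π : Equiv.Perm (Fin n)) : Prop :=
  ∀ x y, x < y → b x = b y → π x < π y

def Dec (b : Fin n → ℕ) (π : Equiv.Perm (Fin n)) : Prop :=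
  ∀ x y, x < y → b x = b y → π y < π x

/-- across blocks -/
def Crs (b : Fin n → ℕ) (π : Equiv.Perm (Fin n)) : Prop :=
  ∀ x y, x < y → b x = b y → b (π y) ≤ b (π x)

lemma dec_iff (b : Fin n → ℕ) (hb : Monotone b) (π : Equiv.Perm (Fin n)) :
    Dec b π ↔ Anti b π ∧ Crs b π := by
  constructor
  · intro h
    refine ⟨fun x y hxy hf => h x y hxy ?_, fun x y hxy hf => hb (h x y hxy hf).le⟩
    exact congrArg Prod.fst hf
  · rintro ⟨h1, h2⟩ x y hxy hf
    rcases (h2 x y hxy hf).lt_or_eq with h | h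
    · exact hb.reflect_lt h
    · exact h1 x y hxy (by simp [pr, hf, h])

lemma crs_T (b : Fin n → ℕ) (π : Equiv.Perm (Fin n)) : Crs b (T b π) ↔ Crs b π := by
  have : ∀ a, b (T b π a) = b (π a) := fun a => congrArg Prod.snd (congrFun (pr_T b π) a)
  simp [Crs, this]

noncomputable def W (b : Fin n → ℕ) (π : Equiv.Perm (Fin n)) : Equiv.Perm (Fin n) :=
  rev b * π * rev b

lemma W_W (b : Fin n → ℕ) (π : Equiv.Perm (Fin n)) : W b (W b π) = π := by
  calc W b (W b π) = (rev b * rev b) * π * (rev b * rev b) := by simp only [W, mul_assoc]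
    _ = π := by rw [rev_mul_rev]; simp

lemma W_invol (b : Fin n → ℕ) (π : Equiv.Perm (Fin n)) (h : π * π = 1) :
    W b π * W b π = 1 := by
  calc W b π * W b π = rev b * (π * ((rev b * rev b) * π)) * rev b := by
        simp only [W, mul_assoc]
    _ = 1 := by rw [rev_mul_rev, one_mul, h, mul_one, rev_mul_rev]

lemma W_mix (b : Fin n → ℕ) (hb : Monotone b) (π : Equiv.Perm (Fin n)) (h : Inc b π) :
    Mono b (W b π) ∧ Crs b (W b π) := by
  have r := rev_spec b
  constructor
  · intro x y hxy hf
    have hf1 : b x = b y := congrArg Prod.fst hf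
    have hf2 : b (W b π x) = b (W b π y) := congrArg Prod.snd hf
    simp only [W, Equiv.Perm.mul_apply, r.1] at hf2
    exact r.2 _ _ (h _ _ (r.2 x y hxy hf1) (by rw [r.1, r.1, hf1])) hf2.symm
  · intro x y hxy hf
    simp only [W, Equiv.Perm.mul_apply, r.1]
    exact hb (h _ _ (r.2 x y hxy hf) (by rw [r.1, r.1, hf])).le

lemma W_inc (b : Fin n → ℕ) (hb : Monotone b) (π : Equiv.Perm (Fin n))
    (h : Mono b π) (h' : Crs b π) : Inc b (W b π) := by
  have r := rev_spec b
  intro x y hxy hf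
  have e : b (rev b y) = b (rev b x) := by rw [r.1, r.1, hf]
  have l := r.2 x y hxy hf
  simp only [W, Equiv.Perm.mul_apply]
  rcases (h' _ _ l e).lt_or_eq with hh | hh
  · apply hb.reflect_lt
    rw [r.1, r.1]; exact hh
  · exact r.2 _ _ (h _ _ l (by simp [pr, e, hh])) hh.symm

open Classical in
lemma card_inc_dec (b : Fin n → ℕ) (hb : Monotone b) :
    (univ.filter fun π : Equiv.Perm (Fin n) => π * π = 1 ∧ Inc b π).card =
    (univ.filter fun π : Equiv.Perm (Fin n) => π * π = 1 ∧ Dec b π).card := by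
  refine Finset.card_nbij' (fun π => T b (W b π)) (fun π => W b (T b π)) ?_ ?_ ?_ ?_
  · intro π hπ
    simp only [coe_filter, mem_univ, true_and, Set.mem_ofPred_eq] at hπ ⊢
    obtain ⟨h1, h2⟩ := hπ
    have h3 := W_mix b hb π h2
    exact ⟨T_invol b _ (W_invol b π h1) (Or.inl h3.1),
      (dec_iff b hb _).2 ⟨T_anti b _ h3.1, (crs_T b _).2 h3.2⟩⟩
  · intro π hπ
    simp only [coe_filter, mem_univ, true_and, Set.mem_ofPred_eq] at hπ ⊢
    obtain ⟨h1, h2⟩ := hπ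
    have h3 := (dec_iff b hb π).1 h2
    exact ⟨W_invol b _ (T_invol b π h1 (Or.inr h3.1)),
      W_inc b hb _ (T_mono b _ h3.1) ((crs_T b _).2 h3.2)⟩
  · intro π _
    simp only [T_T, W_W]
  · intro π _
    simp only [T_T, W_W]

def blk (S : Finset (Fin n)) (a : Fin n) : ℕ := (S.filter fun s => s < a).card

lemma blk_mono (S : Finset (Fin n)) : Monotone (blk S) := fun a c h =>
  card_le_card fun s hs => by
    simp only [mem_filter] at hs ⊢
    exact ⟨hs.1, hs.2.trans_le h⟩

lemma blk_lt (S : Finset (Fin n)) (a c s : Fin n) (hs : s ∈ S) (h1 : a ≤ s) (h2 : s < c) :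
    blk S a < blk S c := by
  apply card_lt_card
  rw [Finset.ssubset_iff_of_subset]
  · exact ⟨s, by simp [hs, h2], by simp [h1]⟩
  · intro t ht
    simp only [mem_filter] at ht ⊢
    exact ⟨ht.1, ht.2.trans (h1.trans_lt h2)⟩

lemma local_iff (S : Finset (Fin n)) (R : Fin n → Fin n → Prop)
    (htr : ∀ x y z, R x y → R y z → R x z) :
    (∀ i j : Fin n, (j : ℕ) = i + 1 → i ∉ S → R i j) ↔
      ∀ x y, x < y → blk S x = blk S y → R x y := by
  constructor
  · intro h
    have key : ∀ d : ℕ, ∀ x y : Fin n, (y : ℕ) = x + d + 1 → blk S x = blk S y → R x y := by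
      intro d
      induction d with
      | zero =>
        intro x y hxy hbl
        refine h x y (by omega) fun hx => ?_
        exact absurd hbl (blk_lt S x y x hx le_rfl (by rw [Fin.lt_def]; omega)).ne
      | succ d ih =>
        intro x y hxy hbl
        let z : Fin n := ⟨x + d + 1, by omega⟩
        have hxz : x ≤ z := by rw [Fin.le_def]; simp only [z]; omega
        have hzy : z < y := by rw [Fin.lt_def]; simp only [z]; omega
        have e1 : blk S x = blk S z :=
          le_antisymm (blk_mono S hxz) (hbl ▸ blk_mono S hzy.le)
        refine htr x z y (ih x z rfl e1) (h z y (by simp only [z]; omega) fun hz => ?_)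
        exact absurd hbl (blk_lt S x y z hz hxz hzy).ne
    intro x y hxy
    rw [Fin.lt_def] at hxy
    exact key (y - x - 1) x y (by omega)
  · intro h i j hij hi
    refine h i j (by rw [Fin.lt_def]; omega) ?_
    unfold blk
    congr 1
    apply filter_congr
    intro s hs
    have : s ≠ i := fun e => hi (e ▸ hs)
    rw [Ne, Fin.ext_iff] at this
    rw [Fin.lt_def, Fin.lt_def]
    omega

def D (π : Equiv.Perm (Fin n)) : Finset (Fin n) :=
  univ.filter fun i : Fin n => ∃ j : Fin n, (j : ℕ) = (i : ℕ) + 1 ∧ π j < π i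

def A (π : Equiv.Perm (Fin n)) : Finset (Fin n) :=
  univ.filter fun i : Fin n => ∃ j : Fin n, (j : ℕ) = (i : ℕ) + 1 ∧ π i < π j

lemma D_sub (S : Finset (Fin n)) (π : Equiv.Perm (Fin n)) : D π ⊆ S ↔ Inc (blk S) π := by
  unfold Inc
  rw [← local_iff S (fun x y => π x < π y) (fun _ _ _ => lt_trans)]
  constructor
  · intro h i j hij hi
    by_contra hc
    have hne : π i ≠ π j := fun e => by
      have := π.injective e
      rw [this] at hij; omega
    exact hi (h (by simp only [D, mem_filter, mem_univ, true_and]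
                    exact ⟨j, hij, lt_of_le_of_ne (not_lt.mp hc) hne.symm⟩))
  · intro h i hi
    simp only [D, mem_filter, mem_univ, true_and] at hi
    obtain ⟨j, hj, hlt⟩ := hi
    by_contra hc
    exact absurd (h i j hj hc) (not_lt.mpr hlt.le)

lemma A_sub (S : Finset (Fin n)) (π : Equiv.Perm (Fin n)) : A π ⊆ S ↔ Dec (blk S) π := by
  unfold Dec
  rw [← local_iff S (fun x y => π y < π x) (fun _ _ _ h h' => lt_trans h' h)]
  constructor
  · intro h i j hij hi
    by_contra hc
    have hne : π i ≠ π j := fun e => by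
      have := π.injective e
      rw [this] at hij; omega
    exact hi (h (by simp only [A, mem_filter, mem_univ, true_and]
                    exact ⟨j, hij, lt_of_le_of_ne (not_lt.mp hc) hne⟩))
  · intro h i hi
    simp only [A, mem_filter, mem_univ, true_and] at hi
    obtain ⟨j, hj, hlt⟩ := hi
    by_contra hc
    exact absurd (h i j hj hc) (not_lt.mpr hlt.le)

def inv (n : ℕ) : Finset (Equiv.Perm (Fin n)) := univ.filter fun π => π * π = 1

lemma card_sub (S : Finset (Fin n)) :
    ((inv n).filter fun π => D π ⊆ S).card = ((inv n).filter fun π => A π ⊆ S).card := by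
  classical
  have := card_inc_dec (blk S) (blk_mono S)
  simp only [inv, filter_filter, D_sub, A_sub]
  convert this

lemma sum_sub (F : Equiv.Perm (Fin n) → Finset (Fin n)) (S : Finset (Fin n)) :
    ((inv n).filter fun π => F π ⊆ S).card =
      ∑ U ∈ S.powerset, ((inv n).filter fun π => F π = U).card := by
  rw [Finset.card_eq_sum_card_fiberwise (f := F) (t := S.powerset)]
  · refine sum_congr rfl fun U hU => ?_
    rw [filter_filter]
    congr 1
    apply filter_congr
    intro π _
    rw [mem_powerset] at hU
    exact ⟨fun h => h.2, fun h => ⟨h ▸ hU, h⟩⟩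
  · intro π hπ
    simp only [coe_filter, Set.mem_ofPred_eq] at hπ
    simpa using hπ.2

lemma card_eq (S : Finset (Fin n)) :
    ((inv n).filter fun π => D π = S).card = ((inv n).filter fun π => A π = S).card := by
  induction S using Finset.strongInduction with
  | H S ih =>
    have h := card_sub S
    rw [sum_sub, sum_sub, ← Finset.sum_erase_add _ _ (mem_powerset_self S),
      ← Finset.sum_erase_add _ _ (mem_powerset_self S)] at h
    have e : ∑ U ∈ S.powerset.erase S, ((inv n).filter fun π => D π = U).card =
        ∑ U ∈ S.powerset.erase S, ((inv n).filter fun π => A π = U).card := by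
      refine sum_congr rfl fun U hU => ih U ?_
      rw [mem_erase, mem_powerset] at hU
      exact hU.2.ssubset_of_ne hU.1
    omega

lemma sum_card (F : Equiv.Perm (Fin n) → Finset (Fin n)) (k : ℕ) :
    ((inv n).filter fun π => (F π).card = k).card =
      ∑ U ∈ univ.powersetCard k, ((inv n).filter fun π => F π = U).card := by
  rw [Finset.card_eq_sum_card_fiberwise (f := F) (t := univ.powersetCard k)]
  · refine sum_congr rfl fun U hU => ?_
    rw [filter_filter]
    congr 1
    apply filter_congr
    intro π _
    rw [mem_powersetCard] at hU
    exact ⟨fun h => h.2, fun h => ⟨h ▸ hU.2, h⟩⟩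
  · intro π hπ
    simp only [coe_filter, Set.mem_ofPred_eq] at hπ
    simpa [mem_powersetCard] using hπ.2

lemma card_A_add_D (hn : 1 ≤ n) (π : Equiv.Perm (Fin n)) :
    (A π).card + (D π).card = n - 1 := by
  rw [← card_union_of_disjoint]
  · have : A π ∪ D π = univ.erase (⟨n - 1, by omega⟩ : Fin n) := by
      ext i
      simp only [A, D, mem_union, mem_filter, mem_univ, true_and, mem_erase, and_true, Ne,
        Fin.ext_iff]
      constructor
      · rintro (⟨j, hj, _⟩ | ⟨j, hj, _⟩) <;> omega
      · intro hi
        have hi2 := i.2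
        let j : Fin n := ⟨i + 1, by omega⟩
        have hne : π i ≠ π j := fun e => by
          have := congrArg Fin.val (π.injective e)
          simp only [j] at this; omega
        rcases lt_or_gt_of_ne hne with h | h
        · exact Or.inl ⟨j, rfl, h⟩
        · exact Or.inr ⟨j, rfl, h⟩
    rw [this, card_erase_of_mem (mem_univ _)]
    simp
  · rw [Finset.disjoint_left]
    intro i hA hD
    simp only [A, D, mem_filter, mem_univ, true_and] at hA hD
    obtain ⟨j, hj, h⟩ := hA
    obtain ⟨j', hj', h'⟩ := hD
    have : j = j' := Fin.ext (by omega)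
    subst this
    exact absurd h (not_lt.mpr h'.le)

end InvSymm

/-- Symmetry of the descent distribution on involutions: `I_{n,k} = I_{n,n-1-k}`. -/
theorem invCount_symm (n : ℕ) (hn : 1 ≤ n) (k : ℕ) (hk : k ≤ n - 1) :
    invCount n k = invCount n (n - 1 - k) := by
  have e : ∀ m, invCount n m =
      ((InvSymm.inv n).filter fun π => (InvSymm.D π).card = m).card := by
    intro m
    rw [InvSymm.inv, filter_filter]
    rfl
  rw [e, e, InvSymm.sum_card, sum_congr rfl fun U _ => InvSymm.card_eq U, ← InvSymm.sum_card]
  congr 1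
  apply filter_congr
  intro π _
  have := InvSymm.card_A_add_D hn π
  omega
end

section
/- For all n ≥ 1 and all 0 ≤ k ≤ 2n, J_{2n,k} = J_{2n,2n-k}; that is, the distribution of the descent number over fixed-point-free involutions of {1,...,2n} is symmetric about n. -/
open Finset Polynomial

namespace FpfSymm

/-- `π` is an involution without fixed points, and `g` is weakly increasing, strictly at
descents of `π`. -/
def Good {N m : ℕ} (π : Equiv.Perm (Fin N)) (g : Fin N → Fin m) : Prop :=
  (π * π = 1 ∧ ∀ i, π i ≠ i) ∧ Monotone g ∧
    ∀ i j : Fin N, (j : ℕ) = (i : ℕ) + 1 → π j < π i → g i < g j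

def word {N m : ℕ} (π : Equiv.Perm (Fin N)) (g : Fin N → Fin m) (x : Fin N) :
    Fin m ×ₗ Fin m := toLex (g x, g (π x))

def sw {m : ℕ} (p : Fin m ×ₗ Fin m) : Fin m ×ₗ Fin m :=
  toLex ((ofLex p).2, (ofLex p).1)

theorem sw_sw {m : ℕ} (p : Fin m ×ₗ Fin m) : sw (sw p) = p := rfl

theorem invol {N : ℕ} {π : Equiv.Perm (Fin N)} (h : π * π = 1) (x : Fin N) : π (π x) = x := by
  have := congrArg (fun σ : Equiv.Perm (Fin N) => σ x) h
  simpa using this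

theorem Good.lt {N m : ℕ} {π : Equiv.Perm (Fin N)} {g : Fin N → Fin m} (h : Good π g)
    (k : ℕ) : ∀ x y : Fin N, (y : ℕ) = x + k + 1 → g x = g y → π x < π y := by
  obtain ⟨-, hm, hd⟩ := h
  have step : ∀ x y : Fin N, (y : ℕ) = x + 1 → g x = g y → π x < π y := by
    intro x y hxy hg
    have h1 : ¬ π y < π x := fun hlt => (hd x y hxy hlt).ne hg
    refine lt_of_le_of_ne (not_lt.1 h1) fun he => ?_
    have := π.injective he
    subst this
    omega
  induction k with
  | zero => intro x y hxy hg; exact step x y (by omega) hg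
  | succ k ih =>
    intro x y hxy hg
    let z : Fin N := ⟨x + k + 1, by omega⟩
    have hz1 : g x ≤ g z := hm (by rw [Fin.le_def]; simp [z]; omega)
    have hz2 : g z ≤ g y := hm (by rw [Fin.le_def]; simp [z]; omega)
    have e1 : g x = g z := le_antisymm hz1 (hg ▸ hz2)
    exact (ih x z rfl e1).trans (step z y (by simp [z]; omega) (e1 ▸ hg))

theorem Good.lt' {N m : ℕ} {π : Equiv.Perm (Fin N)} {g : Fin N → Fin m} (h : Good π g)
    {x y : Fin N} (hxy : x < y) (hg : g x = g y) : π x < π y :=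
  h.lt (y - x - 1) x y (by rw [Fin.lt_def] at hxy; omega) hg

theorem Good.mono {N m : ℕ} {π : Equiv.Perm (Fin N)} {g : Fin N → Fin m} (h : Good π g) :
    Monotone (word π g) := by
  intro x y hxy
  rcases hxy.eq_or_lt with rfl | hlt
  · rfl
  unfold word
  rw [Prod.Lex.toLex_le_toLex]
  rcases (h.2.1 hxy).eq_or_lt with he | hl
  · exact Or.inr ⟨he, h.2.1 (h.lt' hlt he).le⟩
  · exact Or.inl hl

theorem Good.word_perm {N m : ℕ} {π : Equiv.Perm (Fin N)} {g : Fin N → Fin m} (h : Good π g)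
    (x : Fin N) : word π g (π x) = sw (word π g x) := by
  simp [word, sw, invol h.1.1]

theorem Good.eq_sort {N m : ℕ} {π : Equiv.Perm (Fin N)} {g : Fin N → Fin m} (h : Good π g) :
    π = Tuple.sort (sw ∘ word π g) := by
  have key : (sw ∘ word π g) ∘ π = word π g := by
    funext x
    simp [h.word_perm, sw_sw]
  rw [Tuple.eq_sort_iff, key]
  refine ⟨h.mono, fun i j hij he => ?_⟩
  have he' : word π g i = word π g j := by
    have h1 := congrFun key i
    have h2 := congrFun key j
    simp only [Function.comp_apply] at h1 h2 he
    rw [← h1, ← h2, he]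
  exact h.lt' hij (congrArg (fun p => (ofLex p).1) he')

theorem Good.offdiag {N m : ℕ} {π : Equiv.Perm (Fin N)} {g : Fin N → Fin m} (h : Good π g)
    (x : Fin N) : g x ≠ g (π x) := by
  intro he
  rcases lt_or_gt_of_ne (h.1.2 x) with hl | hl
  · have := h.lt' hl he.symm
    rw [invol h.1.1] at this
    exact absurd this hl.asymm
  · have := h.lt' hl he
    rw [invol h.1.1] at this
    exact absurd this hl.asymm

def full {N m : ℕ} (w : Fin N → Fin m ×ₗ Fin m) : Multiset (Fin m ×ₗ Fin m) :=
  (Finset.univ : Finset (Fin N)).val.map w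

theorem full_eq {N m : ℕ} (w : Fin N → Fin m ×ₗ Fin m) : full w = (List.ofFn w : Multiset _) := by
  simp [full, Fin.univ_val_map]

theorem full_inj {N m : ℕ} {w w' : Fin N → Fin m ×ₗ Fin m} (hw : Monotone w) (hw' : Monotone w')
    (h : full w = full w') : w = w' := by
  rw [full_eq, full_eq, Multiset.coe_eq_coe] at h
  exact List.ofFn_injective (h.eq_of_pairwise' hw.sortedLE_ofFn.pairwise hw'.sortedLE_ofFn.pairwise)

theorem Good.inj {N m : ℕ} {π π' : Equiv.Perm (Fin N)} {g g' : Fin N → Fin m} (h : Good π g)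
    (h' : Good π' g') (he : full (word π g) = full (word π' g')) : π = π' ∧ g = g' := by
  have hw := full_inj h.mono h'.mono he
  refine ⟨by rw [h.eq_sort, h'.eq_sort, hw], ?_⟩
  funext x
  exact congrArg (fun p => (ofLex p).1) (congrFun hw x)

theorem eq_one_of_fibre {N : ℕ} {α : Type*} (w : Fin N → α) (σ : Equiv.Perm (Fin N))
    (h1 : ∀ x, w (σ x) = w x) (h2 : ∀ x y, x < y → w x = w y → σ x < σ y) : σ = 1 := by
  have : ∀ x, σ x = x := by
    intro x
    induction x using WellFoundedLT.induction with
    | ind x ih =>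
      by_contra hne
      obtain ⟨z, hz⟩ := σ.surjective x
      have hwz : w x = w z := by rw [← h1 z, hz]
      have hzx : ¬ z < x := fun hl => by
        have := ih z hl
        rw [hz] at this
        exact hl.ne this.symm
      have hzx' : z ≠ x := fun e => hne (e ▸ hz)
      have hl : x < z := lt_of_le_of_ne (not_lt.1 hzx) hzx'.symm
      have h3 := h2 x z hl hwz
      rw [hz] at h3
      have := ih _ h3
      exact hne (σ.injective this)
  ext x
  simp [this]

/-- Existence: any swap invariant off-diagonal multiset comes from a good pair. -/
theorem exists_good {N m : ℕ} (F : Multiset (Fin m ×ₗ Fin m)) (hc : F.card = N)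
    (hs : F.map sw = F) (hd : ∀ p ∈ F, (ofLex p).1 ≠ (ofLex p).2) :
    ∃ (π : Equiv.Perm (Fin N)) (g : Fin N → Fin m), Good π g ∧ full (word π g) = F := by
  obtain ⟨w, hw, hF⟩ : ∃ w : Fin N → Fin m ×ₗ Fin m, Monotone w ∧ full w = F := by
    subst hc
    let l := F.sort (· ≤ ·)
    have hl : l.length = F.card := by simp [l]
    refine ⟨fun i => l.get (i.cast hl.symm), ?_, ?_⟩
    · intro i j hij
      have hp : l.SortedLE := (F.pairwise_sort (· ≤ ·)).sortedLE
      exact hp.monotone_get (by simpa using hij)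
    · rw [full_eq]
      have : List.ofFn (fun i : Fin F.card => l.get (i.cast hl.symm)) = l := by
        apply List.ext_get
        · simp [hl]
        · intro n h1 h2
          simp
      rw [this]
      simp [l]
  have hsw : Tuple.sort (sw ∘ w) = Tuple.sort (sw ∘ w) := rfl
  set π := Tuple.sort (sw ∘ w) with hπ
  obtain ⟨hmo, hti⟩ := Tuple.eq_sort_iff.1 hπ
  have key : (sw ∘ w) ∘ π = w := by
    apply full_inj hmo hw
    have e1 : full ((sw ∘ w) ∘ π) = full (sw ∘ w) := by
      rw [full_eq, full_eq, Multiset.coe_eq_coe]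
      exact π.ofFn_comp_perm _
    rw [e1, hF]
    unfold full
    rw [← Multiset.map_map]
    change Multiset.map sw (full w) = F
    rw [hF, hs]
  have k1 : ∀ x, w (π x) = sw (w x) := fun x => by
    have := congrFun key x
    simp only [Function.comp_apply] at this
    rw [← this, sw_sw]
  have k2 : ∀ x y, x < y → w x = w y → π x < π y := by
    intro x y hxy he
    apply hti x y hxy
    simp [k1, he]
  have hinv : π * π = 1 := by
    apply eq_one_of_fibre w
    · intro x; simp [k1, sw_sw]
    · intro x y hxy he
      exact k2 _ _ (k2 x y hxy he) (by rw [k1, k1, he])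
  have hword : word π (fun x => (ofLex (w x)).1) = w := by
    funext x
    simp only [word, k1]
    rfl
  refine ⟨π, fun x => (ofLex (w x)).1, ⟨⟨hinv, ?_⟩, ?_, ?_⟩, by rw [hword, hF]⟩
  · intro x hx
    have h1 := k1 x
    rw [hx] at h1
    have hm : w x ∈ F := by rw [← hF]; simp [full]
    exact hd _ hm (congrArg (fun p => (ofLex p).1) h1)
  · intro x y hxy
    have := hw hxy
    rw [Prod.Lex.le_iff] at this
    rcases this with h | h
    · exact h.le
    · exact h.1.le
  · intro x y hxy hlt
    have hxy' : x < y := by rw [Fin.lt_def]; omega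
    have h1 := hw hxy'.le
    have hne : w x ≠ w y := fun he => (k2 x y hxy' he).asymm hlt
    have h1 := lt_of_le_of_ne h1 hne
    rw [Prod.Lex.lt_iff] at h1
    rcases h1 with h | h
    · exact h
    · exfalso
      have h2 : w (π y) ≤ w (π x) := hw hlt.le
      rw [k1, k1, Prod.Lex.le_iff] at h2
      rcases h2 with h2 | h2
      · exact absurd h2 h.2.asymm
      · exact absurd h2.1 h.2.ne'

abbrev Pr (m : ℕ) := {p : Fin m ×ₗ Fin m // (ofLex p).1 < (ofLex p).2}

def dbl {m : ℕ} (s : Multiset (Pr m)) : Multiset (Fin m ×ₗ Fin m) :=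
  s.map Subtype.val + (s.map Subtype.val).map sw

theorem filter_dbl {m : ℕ} (s : Multiset (Pr m)) :
    (dbl s).filter (fun p => (ofLex p).1 < (ofLex p).2) = s.map Subtype.val := by
  unfold dbl
  rw [Multiset.filter_add, Multiset.filter_eq_self.2, Multiset.filter_eq_nil.2, add_zero]
  · intro p hp
    simp only [Multiset.mem_map] at hp
    obtain ⟨_, ⟨q, -, rfl⟩, rfl⟩ := hp
    exact q.2.asymm
  · intro p hp
    simp only [Multiset.mem_map] at hp
    obtain ⟨q, -, rfl⟩ := hp
    exact q.2

theorem dbl_inj {m : ℕ} {s t : Multiset (Pr m)} (h : dbl s = dbl t) : s = t := by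
  have := filter_dbl s
  rw [h, filter_dbl] at this
  exact (Multiset.map_injective Subtype.val_injective this).symm

theorem exists_dbl {m : ℕ} (F : Multiset (Fin m ×ₗ Fin m))
    (hs : F.map sw = F) (hd : ∀ p ∈ F, (ofLex p).1 ≠ (ofLex p).2) :
    ∃ s : Multiset (Pr m), dbl s = F := by
  obtain ⟨s, hs'⟩ : ∃ s : Multiset (Pr m), s.map Subtype.val =
      F.filter (fun p => (ofLex p).1 < (ofLex p).2) := by
    have := CanLift.prf (α := Multiset (Fin m ×ₗ Fin m)) (β := Multiset (Pr m))
      (F.filter (fun p => (ofLex p).1 < (ofLex p).2)) (by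
        intro p hp
        exact (Multiset.mem_filter.1 hp).2)
    exact this
  refine ⟨s, ?_⟩
  unfold dbl
  rw [hs']
  conv_rhs => rw [← Multiset.filter_add_not (fun p => (ofLex p).1 < (ofLex p).2) F]
  congr 1
  conv_rhs => rw [← hs]
  rw [Multiset.filter_map]
  congr 1
  apply Multiset.filter_congr
  intro p hp
  have := hd p hp
  simp only [sw, Function.comp_apply, ofLex_toLex, not_lt]
  exact ⟨le_of_lt, fun h => lt_of_le_of_ne h this⟩

open Classical in
theorem card_good (n m : ℕ) :
    (Finset.univ.filter fun q : Equiv.Perm (Fin (2 * n)) × (Fin (2 * n) → Fin m) =>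
      Good q.1 q.2).card = (m.choose 2 + n - 1).choose n := by
  have hPr : Fintype.card (Pr m) = m.choose 2 := by
    have h1 : Fintype.card (Pr m) =
        ((Finset.univ : Finset (Fin m × Fin m)).filter (fun p => p.1 < p.2)).card := by
      rw [← Fintype.card_subtype]
      exact Fintype.card_congr (Equiv.subtypeEquiv ofLex (fun _ => Iff.rfl))
    have h2 : ((Finset.univ : Finset (Fin m × Fin m)).filter (fun p => p.1 < p.2)).card =
        ∑ j : Fin m, (Finset.univ.filter fun i : Fin m => i < j).card := by
      simp only [Finset.card_filter]
      rw [Fintype.sum_prod_type_right]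
    have h3 : ∀ j : Fin m, (Finset.univ.filter fun i : Fin m => i < j).card = (j : ℕ) := by
      intro j
      have : (Finset.univ.filter fun i : Fin m => i < j) = Finset.Iio j := by ext; simp
      rw [this, Fin.card_Iio]
    rw [h1, h2, Finset.sum_congr rfl (fun j _ => h3 j), Fin.sum_univ_eq_sum_range (fun i => i),
      Finset.sum_range_id, Nat.choose_two_right]
  rw [← hPr, ← Sym.card_sym_eq_choose, ← Finset.card_univ]
  rw [← Finset.card_image_of_injOn (f := fun q => full (word q.1 q.2)),
    ← Finset.card_image_of_injective (f := fun s : Sym (Pr m) n => dbl (s : Multiset (Pr m)))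
      Finset.univ (fun s t h => Subtype.ext (dbl_inj h))]
  · congr 1
    ext F
    simp only [Finset.mem_image, Finset.mem_filter, Finset.mem_univ, true_and]
    constructor
    · rintro ⟨⟨π, g⟩, h, rfl⟩
      simp only at h
      obtain ⟨s, hs⟩ := exists_dbl (full (word π g)) (by
        have e1 : full (word π g ∘ π) = full (word π g) := by
          rw [full_eq, full_eq, Multiset.coe_eq_coe]
          exact π.ofFn_comp_perm _
        conv_rhs => rw [← e1]
        unfold full
        rw [Multiset.map_map]
        apply Multiset.map_congr rfl
        intro x _
        simp [h.word_perm]) (by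
        intro p hp
        simp only [full, Multiset.mem_map] at hp
        obtain ⟨x, -, rfl⟩ := hp
        exact h.offdiag x)
      refine ⟨⟨s, ?_⟩, hs⟩
      have := congrArg Multiset.card hs
      simp [dbl, full] at this
      omega
    · rintro ⟨⟨s, hc⟩, rfl⟩
      obtain ⟨π, g, h, he⟩ := exists_good (N := 2 * n) (dbl s) (by simp [dbl, hc]; omega) (by
        simp only [dbl, Multiset.map_add, Multiset.map_map]
        rw [add_comm]
        rfl) (by
        intro p hp
        simp only [dbl, Multiset.mem_add, Multiset.mem_map] at hp
        rcases hp with ⟨q, -, rfl⟩ | ⟨_, ⟨q, -, rfl⟩, rfl⟩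
        · exact q.2.ne
        · exact q.2.ne')
      exact ⟨(π, g), h, he⟩
  · rintro ⟨π, g⟩ h ⟨π', g'⟩ h' he
    simp only [Finset.coe_filter, Finset.mem_univ, true_and, Set.mem_ofPred_eq] at h h'
    obtain ⟨rfl, rfl⟩ := h.inj h' he
    rfl

/-- Number of strictly increasing functions. -/
theorem card_strictMono (N m : ℕ) :
    (Finset.univ.filter fun h : Fin N → Fin m => StrictMono h).card = m.choose N := by
  rw [← Finset.card_fin m, ← Finset.card_powersetCard, Finset.card_fin]
  refine Finset.card_bij' (i := fun h _ => Finset.univ.image h)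
    (j := fun s hs => s.orderEmbOfFin (Finset.mem_powersetCard.1 hs).2) ?_ ?_ ?_ ?_
  · intro h hh
    simp only [Finset.mem_filter, Finset.mem_univ, true_and] at hh
    rw [Finset.mem_powersetCard]
    refine ⟨Finset.subset_univ _, ?_⟩
    rw [Finset.card_image_of_injective _ hh.injective, Finset.card_fin]
  · intro s hs
    simp only [Finset.mem_filter, Finset.mem_univ, true_and]
    exact OrderEmbedding.strictMono _
  · intro h hh
    simp only [Finset.mem_filter, Finset.mem_univ, true_and] at hh
    symm
    apply Finset.orderEmbOfFin_unique
    · intro x; simp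
    · exact hh
  · intro s hs
    simp

/-- Number of `a`-shifted functions. `D` is the descent set. -/
theorem card_compat (M r : ℕ) (D : Finset (Fin M)) :
    (Finset.univ.filter fun g : Fin (M + 1) → Fin (r + 1) => Monotone g ∧
      ∀ i ∈ D, g i.castSucc < g i.succ).card = (r + (M + 1) - D.card).choose (M + 1) := by
  have hD : D.card ≤ M := by simpa using D.card_le_univ
  let a : Fin (M + 1) → ℕ := fun x =>
    (Finset.univ.filter fun i : Fin M => i ∉ D ∧ i.castSucc < x).card
  have a_le : ∀ x, a x ≤ x := by
    intro x
    have : a x ≤ (Finset.univ.filter fun i : Fin M => i.castSucc < x).card :=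
      Finset.card_le_card (fun i hi => by simp at hi ⊢; exact hi.2)
    refine this.trans ?_
    have h2 := Finset.card_le_card_of_injOn (s := Finset.univ.filter fun i : Fin M => i.castSucc < x)
      (t := Finset.range x) (fun i => (i : ℕ)) (by
        intro i hi
        simp [Fin.lt_def] at hi ⊢
        exact hi) (fun i _ j _ h => Fin.ext h)
    simpa using h2
  have a_succ_mem : ∀ i ∈ D, a i.succ = a i.castSucc := by
    intro i hi
    simp only [a]
    congr 1
    ext j
    simp only [Finset.mem_filter, Finset.mem_univ, true_and, Fin.lt_def, Fin.val_castSucc,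
      Fin.val_succ]
    constructor
    · rintro ⟨h1, h2⟩
      have : (j : ℕ) ≠ i := fun e => h1 (Fin.ext e ▸ hi)
      exact ⟨h1, by omega⟩
    · rintro ⟨h1, h2⟩
      exact ⟨h1, by omega⟩
  have a_succ_not : ∀ i, i ∉ D → a i.succ = a i.castSucc + 1 := by
    intro i hi
    simp only [a]
    rw [← Finset.card_insert_of_notMem (a := i) (by simp)]
    congr 1
    ext j
    simp only [Finset.mem_filter, Finset.mem_univ, true_and, Fin.lt_def, Fin.val_castSucc,
      Fin.val_succ, Finset.mem_insert]
    constructor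
    · rintro ⟨h1, h2⟩
      by_cases e : j = i
      · exact Or.inl e
      · have : (j : ℕ) ≠ i := fun e' => e (Fin.ext e')
        exact Or.inr ⟨h1, by omega⟩
    · rintro (rfl | ⟨h1, h2⟩)
      · exact ⟨hi, by omega⟩
      · exact ⟨h1, by omega⟩
  have a_last : a (Fin.last M) = M - D.card := by
    simp only [a]
    have : (Finset.univ.filter fun i : Fin M => i ∉ D ∧ i.castSucc < Fin.last M) = Dᶜ := by
      ext i
      simp [Fin.castSucc_lt_last]
    rw [this, Finset.card_compl, Fintype.card_fin]
  have a_mono : Monotone a := by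
    rw [Fin.monotone_iff_le_succ]
    intro i
    by_cases hi : i ∈ D
    · exact (a_succ_mem i hi).ge
    · rw [a_succ_not i hi]; omega
  rw [← card_strictMono]
  have hm : r + (M + 1) - D.card = r + (M - D.card) + 1 := by omega
  rw [hm]
  have key : ∀ h : Fin (M + 1) → Fin (r + (M - D.card) + 1), StrictMono h →
      Monotone (fun x => ((h x : ℕ) : ℤ) - a x) ∧ ∀ x, a x ≤ h x ∧ (h x : ℕ) ≤ a x + r := by
    intro h hh
    have hmo : Monotone (fun x => ((h x : ℕ) : ℤ) - a x) := by
      rw [Fin.monotone_iff_le_succ]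
      intro i
      have h1 := hh (Fin.castSucc_lt_succ (i := i))
      rw [Fin.lt_def] at h1
      by_cases hi : i ∈ D
      · have := a_succ_mem i hi
        omega
      · have := a_succ_not i hi
        omega
    refine ⟨hmo, fun x => ?_⟩
    have h1 := hmo (Fin.zero_le x)
    have h2 := hmo (Fin.le_last x)
    have h3 := a_le 0
    have h4 := (h (Fin.last M)).2
    simp only [Fin.val_zero] at h1 h2 h3
    omega
  refine Finset.card_bij'
    (i := fun g _ x => (⟨g x + a x, by
      have := a_mono (Fin.le_last x)
      have := (g x).2
      omega⟩ : Fin (r + (M - D.card) + 1)))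
    (j := fun h _ x => (⟨min (h x - a x) r, by omega⟩ : Fin (r + 1))) ?_ ?_ ?_ ?_
  · intro g hg
    simp only [Finset.mem_filter, Finset.mem_univ, true_and] at hg ⊢
    rw [Fin.strictMono_iff_lt_succ]
    intro i
    rw [Fin.lt_def]
    simp only
    by_cases hi : i ∈ D
    · have h1 := hg.2 i hi
      rw [Fin.lt_def] at h1
      rw [a_succ_mem i hi]; omega
    · have h1 := hg.1 (Fin.castSucc_le_succ i)
      rw [Fin.le_def] at h1
      rw [a_succ_not i hi]; omega
  · intro h hh
    simp only [Finset.mem_filter, Finset.mem_univ, true_and] at hh ⊢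
    obtain ⟨hmo, hb⟩ := key h hh
    constructor
    · intro x y hxy
      have h1 := hmo hxy
      have h2 := hb x
      have h3 := hb y
      rw [Fin.le_def]
      simp only at h1 ⊢
      omega
    · intro i hi
      have h1 := hh (Fin.castSucc_lt_succ (i := i))
      have h2 := hb i.castSucc
      have h3 := hb i.succ
      have h4 := a_succ_mem i hi
      rw [Fin.lt_def] at h1 ⊢
      simp only
      omega
  · intro g hg
    funext x
    apply Fin.ext
    have := (g x).2
    simp
    omega
  · intro h hh
    simp only [Finset.mem_filter, Finset.mem_univ, true_and] at hh
    funext x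
    apply Fin.ext
    have h2 := (key h hh).2 x
    simp only
    omega

/-- Reciprocity for the binomial polynomial. -/
theorem poly_symm (N n : ℕ) (hN : Even N) (hn : 1 ≤ n) (J : ℕ → ℕ)
    (h : ∀ r : ℕ, ∑ k ∈ Finset.range (N + 1), J k * (r + N - k).choose N =
      ((r + 1).choose 2 + n - 1).choose n) (r : ℕ) :
    ∑ k ∈ Finset.range (N + 1), J k * (r + k).choose N =
      ∑ k ∈ Finset.range (N + 1), J k * (r + N - k).choose N := by
  let Q : ℚ[X] := ∑ k ∈ Finset.range (N + 1),
    Polynomial.C ((J k : ℚ) / N.factorial) * (descPochhammer ℚ N).comp (X + Polynomial.C ((N : ℚ) - k))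
  let R : ℚ[X] := Polynomial.C (1 / (n.factorial : ℚ)) *
    (descPochhammer ℚ n).comp (Polynomial.C (1 / 2) * (X * (X + 1)) + Polynomial.C ((n : ℚ) - 1))
  have hQ : ∀ r : ℕ, Q.eval (r : ℚ) =
      ((∑ k ∈ Finset.range (N + 1), J k * (r + N - k).choose N : ℕ) : ℚ) := by
    intro r
    simp only [Q, Polynomial.eval_finsetSum, Nat.cast_sum]
    apply Finset.sum_congr rfl
    intro k hk
    have hk' : k ≤ r + N := by rw [Finset.mem_range] at hk; omega
    rw [Nat.cast_mul, Nat.cast_choose_eq_descPochhammer_div, Nat.cast_sub hk']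
    simp only [Polynomial.eval_mul, Polynomial.eval_C, Polynomial.eval_comp, Polynomial.eval_add,
      Polynomial.eval_X]
    push_cast
    rw [← add_sub_assoc]
    ring
  have hR : ∀ r : ℕ, R.eval (r : ℚ) = ((((r + 1).choose 2 + n - 1).choose n : ℕ) : ℚ) := by
    intro r
    rw [Nat.cast_choose_eq_descPochhammer_div, Nat.cast_sub (by omega), Nat.cast_add,
      Nat.cast_choose_two]
    simp only [R, Polynomial.eval_mul, Polynomial.eval_C, Polynomial.eval_comp,
      Polynomial.eval_add, Polynomial.eval_X, Polynomial.eval_one]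
    push_cast
    rw [one_div_mul_eq_div]
    congr 2
    ring
  have hQR : Q = R := by
    apply Polynomial.eq_of_infinite_eval_eq
    apply (Set.infinite_range_of_injective (Nat.cast_injective (R := ℚ))).mono
    rintro _ ⟨r, rfl⟩
    simp only [Set.mem_ofPred_eq]
    rw [hQ, hR, h]
  have hsym : R.eval (-1 - (r : ℚ)) = R.eval (r : ℚ) := by
    simp only [R, Polynomial.eval_mul, Polynomial.eval_C, Polynomial.eval_comp,
      Polynomial.eval_add, Polynomial.eval_X, Polynomial.eval_one]
    congr 2
    ring
  have hQ' : Q.eval (-1 - (r : ℚ)) =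
      ((∑ k ∈ Finset.range (N + 1), J k * (r + k).choose N : ℕ) : ℚ) := by
    simp only [Q, Polynomial.eval_finsetSum, Nat.cast_sum]
    apply Finset.sum_congr rfl
    intro k hk
    rw [Nat.cast_mul, Nat.cast_choose_eq_descPochhammer_div]
    simp only [Polynomial.eval_mul, Polynomial.eval_C, Polynomial.eval_comp, Polynomial.eval_add,
      Polynomial.eval_X]
    have : (descPochhammer ℚ N).eval (-1 - (r : ℚ) + (N - k)) =
        (descPochhammer ℚ N).eval ((r + k : ℕ) : ℚ) := by
      rw [descPochhammer_eval_eq_prod_range, descPochhammer_eval_eq_prod_range,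
        ← Finset.prod_range_reflect]
      have e : ∏ j ∈ Finset.range N, (((r + k : ℕ) : ℚ) - (j : ℚ)) =
          ∏ j ∈ Finset.range N, (-(((r + k : ℕ) : ℚ) - (j : ℚ))) := by
        rw [Finset.prod_neg, Finset.card_range, hN.neg_one_pow, one_mul]
      rw [e]
      apply Finset.prod_congr rfl
      intro j hj
      rw [Finset.mem_range] at hj
      rw [Nat.sub_sub, Nat.cast_sub (by omega)]
      push_cast
      ring
    rw [this]
    ring
  have : ((∑ k ∈ Finset.range (N + 1), J k * (r + k).choose N : ℕ) : ℚ) =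
      ((∑ k ∈ Finset.range (N + 1), J k * (r + N - k).choose N : ℕ) : ℚ) := by
    rw [← hQ', ← hQ, hQR, hsym]
  exact_mod_cast this

theorem unique_coeff (N : ℕ) (J K : ℕ → ℕ)
    (h : ∀ r, ∑ k ∈ Finset.range (N + 1), J k * (r + N - k).choose N =
      ∑ k ∈ Finset.range (N + 1), K k * (r + N - k).choose N) (r : ℕ) (hr : r ≤ N) :
    J r = K r := by
  induction r using Nat.strong_induction_on with
  | _ r ih =>
    have key : ∀ J : ℕ → ℕ, ∑ k ∈ Finset.range (N + 1), J k * (r + N - k).choose N =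
        ∑ k ∈ Finset.range r, J k * (r + N - k).choose N + J r := by
      intro J
      rw [← Finset.sum_subset (s₁ := Finset.range (r + 1)), Finset.sum_range_succ]
      · simp
      · intro x hx
        simp only [Finset.mem_range] at hx ⊢
        omega
      · intro x hx hx'
        simp only [Finset.mem_range] at hx hx'
        rw [Nat.choose_eq_zero_of_lt (by omega), mul_zero]
    have h1 := h r
    rw [key, key] at h1
    have h2 : ∑ k ∈ Finset.range r, J k * (r + N - k).choose N =
        ∑ k ∈ Finset.range r, K k * (r + N - k).choose N := by
      apply Finset.sum_congr rfl
      intro k hk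
      rw [Finset.mem_range] at hk
      rw [ih k hk (by omega)]
    omega

open Classical in
theorem card_compat_perm (N : ℕ) (hN : 1 ≤ N) (r : ℕ) (π : Equiv.Perm (Fin N)) :
    (Finset.univ.filter fun g : Fin N → Fin (r + 1) => Monotone g ∧
      ∀ i j : Fin N, (j : ℕ) = (i : ℕ) + 1 → π j < π i → g i < g j).card =
      (r + N - desNum π).choose N := by
  obtain ⟨M, rfl⟩ : ∃ M, N = M + 1 := ⟨N - 1, by omega⟩
  let D : Finset (Fin M) := Finset.univ.filter fun i => π i.succ < π i.castSucc
  have hD : desNum π = D.card := by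
    unfold desNum
    rw [← Finset.card_image_of_injective D (Fin.castSucc_injective M)]
    congr 1
    ext i
    simp only [D, Finset.mem_filter, Finset.mem_univ, true_and, Finset.mem_image]
    constructor
    · rintro ⟨j, hj, hlt⟩
      refine ⟨⟨i, by omega⟩, ?_, rfl⟩
      have e2 : (⟨i, by omega⟩ : Fin M).succ = j := Fin.ext hj.symm
      rw [e2]
      exact hlt
    · rintro ⟨k, hk, rfl⟩
      exact ⟨k.succ, by simp, hk⟩
  rw [hD, ← card_compat]
  congr 1
  ext g
  simp only [D, Finset.mem_filter, Finset.mem_univ, true_and]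
  refine and_congr_right fun _ => ⟨fun h i hi => h _ _ (by simp) hi, fun h i j hj hlt => ?_⟩
  have e1 : (⟨i, by omega⟩ : Fin M).castSucc = i := rfl
  have e2 : (⟨i, by omega⟩ : Fin M).succ = j := Fin.ext hj.symm
  have := h ⟨i, by omega⟩ (by rw [e1, e2]; exact hlt)
  rwa [e1, e2] at this

theorem main_count (n : ℕ) (hn : 1 ≤ n) (r : ℕ) :
    ∑ k ∈ Finset.range (2 * n + 1), fpfInvCount (2 * n) k * (r + 2 * n - k).choose (2 * n) =
      ((r + 1).choose 2 + n - 1).choose n := by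
  classical
  rw [← card_good n (r + 1)]
  let S : Finset (Equiv.Perm (Fin (2 * n))) :=
    Finset.univ.filter fun π => π * π = 1 ∧ ∀ i, π i ≠ i
  have h1 : (Finset.univ.filter fun q : Equiv.Perm (Fin (2 * n)) × (Fin (2 * n) → Fin (r + 1)) =>
      Good q.1 q.2).card = ∑ π ∈ S, (r + 2 * n - desNum π).choose (2 * n) := by
    rw [Finset.card_filter, Fintype.sum_prod_type, Finset.sum_filter]
    apply Finset.sum_congr rfl
    intro π _
    split_ifs with hπ
    · rw [← card_compat_perm (2 * n) (by omega) r π, Finset.card_filter]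
      apply Finset.sum_congr rfl
      intro g _
      congr 1
      simp only [Good, eq_iff_iff]
      exact ⟨fun h => h.2, fun h => ⟨hπ, h⟩⟩
    · apply Finset.sum_eq_zero
      intro g _
      rw [if_neg]
      exact fun h => hπ h.1
  rw [h1, ← Finset.sum_fiberwise_of_maps_to (t := Finset.range (2 * n + 1)) (g := desNum)]
  · apply Finset.sum_congr rfl
    intro k _
    rw [Finset.sum_congr rfl (g := fun _ => (r + 2 * n - k).choose (2 * n))]
    · rw [Finset.sum_const, smul_eq_mul]
      congr 1
      unfold fpfInvCount
      congr 1
      ext π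
      simp [S, and_assoc]
    · intro π hπ
      rw [(Finset.mem_filter.1 hπ).2]
  · intro π _
    rw [Finset.mem_range, Nat.lt_succ_iff]
    unfold desNum
    exact (Finset.card_le_univ _).trans (by simp)

end FpfSymm

/-- Symmetry of the descent distribution on fixed-point-free involutions:
`J_{2n,k} = J_{2n,2n-k}`. -/
theorem fpfInvCount_symm (n : ℕ) (hn : 1 ≤ n) (k : ℕ) (hk : k ≤ 2 * n) :
    fpfInvCount (2 * n) k = fpfInvCount (2 * n) (2 * n - k) := by
  refine FpfSymm.unique_coeff (2 * n) (fpfInvCount (2 * n))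
    (fun k => fpfInvCount (2 * n) (2 * n - k)) (fun r => ?_) k hk
  rw [← FpfSymm.poly_symm (2 * n) n (even_two_mul n) hn _ (FpfSymm.main_count n hn) r,
    ← Finset.sum_range_reflect]
  apply Finset.sum_congr rfl
  intro j hj
  rw [Finset.mem_range] at hj
  have e1 : 2 * n + 1 - 1 - j = 2 * n - j := by omega
  have e2 : r + (2 * n - j) = r + 2 * n - j := by omega
  rw [e1, e2]
end
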